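/- Let A be a unital separable locally C*-algebra and S ⊆ A a local operator system with C*(S) = A. Then J = ⋂_{π ∈ Ch(S)} ker π is the largest local boundary ideal for S: every local boundary ideal I for S satisfies I ⊆ J. In particular, the local Shilov boundary ideal for S exists and is unique. -/

import Mathlib

open scoped ComplexOrder

/-- A C*-seminorm on a complex *-algebra. -/
structure IsCstarSeminorm {A : Type*} [Ring A] [StarRing A] [Algebra ℂ A] (p : A → ℝ) : Prop where
  nonneg : ∀ a, 0 ≤ p a
  map_zero' : p 0 = 0
  add_le : ∀ a b, p (a + b) ≤ p a + p b
  smul : ∀ (c : ℂ) (a : A), p (c • a) = ‖c‖ * p a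
  mul_le : ∀ a b, p (a * b) ≤ p a * p b
  star_eq : ∀ a, p (star a) = p a
  cstar : ∀ a, p (star a * a) = p a ^ 2

/-- The family of canonical C*-seminorms on the matrix algebras `Mₙ(A)` induced by a
C*-seminorm `p` on `A`. -/
structure IsMatrixCstarSeminormFamily {A : Type*} [Ring A] [StarRing A] [Algebra ℂ A]
    (p : A → ℝ) (pn : ∀ n : ℕ, Matrix (Fin n) (Fin n) A → ℝ) : Prop where
  cstar : ∀ n, IsCstarSeminorm (pn n)
  ker : ∀ n (M : Matrix (Fin n) (Fin n) A), pn n M = 0 ↔ ∀ i j, p (M i j) = 0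
  one : ∀ a : A, pn 1 (fun _ _ => a) = p a

/-- `λ`-positivity of a matrix over `A` relative to the matrix seminorm `pn` (at level `λ`):
`M = b*b + c` with `pn c = 0`. -/
def LamPos {A : Type*} [Ring A] [StarRing A]
    (pn : ∀ n : ℕ, Matrix (Fin n) (Fin n) A → ℝ) (n : ℕ)
    (M : Matrix (Fin n) (Fin n) A) : Prop :=
  ∃ x c : Matrix (Fin n) (Fin n) A, pn n c = 0 ∧ M = star x * x + c

/-- Positivity of a matrix of bounded operators, i.e. positivity in `B(H^{⊕n}) ≅ Mₙ(B(H))`. -/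
def MatPosOp {H : Type*} [NormedAddCommGroup H] [InnerProductSpace ℂ H] [CompleteSpace H]
    {n : ℕ} (T : Matrix (Fin n) (Fin n) (H →L[ℂ] H)) : Prop :=
  ∃ X : Matrix (Fin n) (Fin n) (H →L[ℂ] H), T = star X * X

/-- The bounded operator on `H^{⊕n}` (with the `ℓ²`-Hilbert space structure) induced by an
`n × n` matrix of bounded operators on `H`. -/
noncomputable def matOp {H : Type*} [NormedAddCommGroup H] [InnerProductSpace ℂ H]
    {n : ℕ} (T : Matrix (Fin n) (Fin n) (H →L[ℂ] H)) :
    PiLp 2 (fun _ : Fin n => H) →L[ℂ] PiLp 2 (fun _ : Fin n => H) :=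
  ((PiLp.continuousLinearEquiv 2 ℂ (fun _ : Fin n => H)).symm :
      ((_ : Fin n) → H) →L[ℂ] PiLp 2 (fun _ : Fin n => H)) ∘L
    (ContinuousLinearMap.pi fun i => ∑ j, (T i j) ∘L (ContinuousLinearMap.proj j)) ∘L
    ((PiLp.continuousLinearEquiv 2 ℂ (fun _ : Fin n => H)) :
      PiLp 2 (fun _ : Fin n => H) →L[ℂ] ((_ : Fin n) → H))

/-- A map into `B(H)` has trivial commutant (irreducibility). -/
def HasTrivialCommutant {R H : Type*} [NormedAddCommGroup H] [InnerProductSpace ℂ H]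
    (φ : R → (H →L[ℂ] H)) : Prop :=
  ∀ T : H →L[ℂ] H, (∀ a, T * φ a = φ a * T) → ∃ c : ℂ, T = c • (1 : H →L[ℂ] H)

/-- Complete positivity at level `λ` for a linear map defined on all of `A`, with values in
`B(H)`: `λ`-positive matrices go to positive operator matrices, and matrices annihilated by the
`λ`-th matrix seminorm go to zero. -/
def IsLamCPmap {A H : Type*} [Ring A] [StarRing A] [Algebra ℂ A]
    [NormedAddCommGroup H] [InnerProductSpace ℂ H] [CompleteSpace H]
    (pn : ∀ n : ℕ, Matrix (Fin n) (Fin n) A → ℝ) (φ : A →ₗ[ℂ] (H →L[ℂ] H)) : Prop :=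
  (∀ (n : ℕ) (M : Matrix (Fin n) (Fin n) A), LamPos pn n M → MatPosOp (M.map φ)) ∧
  (∀ (n : ℕ) (M : Matrix (Fin n) (Fin n) A), pn n M = 0 → M.map φ = 0)

/-- Complete positivity at level `λ` for a linear map defined on a local operator system
`S ⊆ A`, with values in `B(H)`. -/
def IsLamCPmapOn {A H : Type*} [Ring A] [StarRing A] [Algebra ℂ A]
    [NormedAddCommGroup H] [InnerProductSpace ℂ H] [CompleteSpace H]
    (pn : ∀ n : ℕ, Matrix (Fin n) (Fin n) A → ℝ) (S : Submodule ℂ A)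
    (φ : ↥S →ₗ[ℂ] (H →L[ℂ] H)) : Prop :=
  (∀ (n : ℕ) (M : Matrix (Fin n) (Fin n) ↥S), LamPos pn n (M.map Subtype.val) →
      MatPosOp (M.map fun s => φ s)) ∧
  (∀ (n : ℕ) (M : Matrix (Fin n) (Fin n) ↥S), pn n (M.map Subtype.val) = 0 →
      M.map (fun s => φ s) = 0)

/-- Complete positivity (in the C*-algebraic, purely algebraic sense) of a linear map from a
ring with involution to `B(H)`: matrices of the form `x*x` are sent to positive operator
matrices. For a C*-algebra this is the usual notion of complete positivity. -/
def IsCstarCPmap {R H : Type*} [Ring R] [StarRing R] [Algebra ℂ R]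
    [NormedAddCommGroup H] [InnerProductSpace ℂ H] [CompleteSpace H]
    (φ : R →ₗ[ℂ] (H →L[ℂ] H)) : Prop :=
  ∀ (n : ℕ) (M : Matrix (Fin n) (Fin n) R),
    (∃ x : Matrix (Fin n) (Fin n) R, M = star x * x) → MatPosOp (M.map φ)

/-- A boundary representation (in the sense of Arveson) of a C*-algebra `R` for the operator
system `T ⊆ R`: an irreducible representation which is the unique unital completely positive
extension of its restriction to `T`. -/
def IsBoundaryRep {R H : Type*} [Ring R] [StarRing R] [Algebra ℂ R]
    [NormedAddCommGroup H] [InnerProductSpace ℂ H] [CompleteSpace H]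
    (T : Set R) (ψ : R →⋆ₐ[ℂ] (H →L[ℂ] H)) : Prop :=
  HasTrivialCommutant ⇑ψ ∧
  ∀ χ : R →ₗ[ℂ] (H →L[ℂ] H), χ 1 = 1 → IsCstarCPmap χ → (∀ t ∈ T, χ t = ψ t) →
    ∀ b, χ b = ψ b

/-- An admissible local boundary representation of the locally C*-algebra `A` for the local
operator system `S ⊆ A`. -/
def IsAdmLocBdryRep {Λ A H : Type*} [Ring A] [StarRing A] [Algebra ℂ A]
    [NormedAddCommGroup H] [InnerProductSpace ℂ H] [CompleteSpace H]
    (p : Λ → A → ℝ) (pn : Λ → ∀ n : ℕ, Matrix (Fin n) (Fin n) A → ℝ)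
    (S : Submodule ℂ A) (π : A →⋆ₐ[ℂ] (H →L[ℂ] H)) : Prop :=
  HasTrivialCommutant ⇑π ∧
  ∃ l₀ : Λ, (∀ a, ‖π a‖ ≤ p l₀ a) ∧
    ∀ φ : A →ₗ[ℂ] (H →L[ℂ] H), φ 1 = 1 → (∃ l, IsLamCPmap (pn l) φ) →
      (∀ a, ‖φ a‖ ≤ p l₀ a) → (∀ s ∈ S, φ s = π s) → ∀ a, φ a = π a

/-- An admissible local completely positive map between local operator systems
`S₁ ⊆ A₁` and `S₂ ⊆ A₂` (same index set `Λ` of seminorms). -/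
def IsAdmLocCP {Λ A₁ A₂ : Type*} [Ring A₁] [StarRing A₁] [Algebra ℂ A₁]
    [Ring A₂] [StarRing A₂] [Algebra ℂ A₂]
    (pn₁ : Λ → ∀ n : ℕ, Matrix (Fin n) (Fin n) A₁ → ℝ)
    (pn₂ : Λ → ∀ n : ℕ, Matrix (Fin n) (Fin n) A₂ → ℝ)
    (S₁ : Submodule ℂ A₁) (S₂ : Submodule ℂ A₂) (φ : ↥S₁ →ₗ[ℂ] ↥S₂) : Prop :=
  ∀ (l : Λ) (n : ℕ) (M : Matrix (Fin n) (Fin n) ↥S₁),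
    (LamPos (pn₁ l) n (M.map Subtype.val) →
      LamPos (pn₂ l) n (M.map fun s => ((φ s : ↥S₂) : A₂))) ∧
    (pn₁ l n (M.map Subtype.val) = 0 → pn₂ l n (M.map fun s => ((φ s : ↥S₂) : A₂)) = 0)

/-- A local completely isometric map between local operator systems. -/
def IsLocCompIsometric {Λ A₁ A₂ : Type*} [Ring A₁] [StarRing A₁] [Algebra ℂ A₁]
    [Ring A₂] [StarRing A₂] [Algebra ℂ A₂]
    (pn₁ : Λ → ∀ n : ℕ, Matrix (Fin n) (Fin n) A₁ → ℝ)
    (pn₂ : Λ → ∀ n : ℕ, Matrix (Fin n) (Fin n) A₂ → ℝ)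
    (S₁ : Submodule ℂ A₁) (S₂ : Submodule ℂ A₂) (φ : ↥S₁ →ₗ[ℂ] ↥S₂) : Prop :=
  ∀ (l : Λ) (n : ℕ) (M : Matrix (Fin n) (Fin n) ↥S₁),
    pn₂ l n (M.map fun s => ((φ s : ↥S₂) : A₂)) = pn₁ l n (M.map Subtype.val)

/-- A completely positive map (algebraic sense) between operator systems `T₁ ⊆ R₁`, `T₂ ⊆ R₂`
sitting in C*-algebras. -/
def IsCstarCPmapOn {R₁ R₂ : Type*} [Ring R₁] [StarRing R₁] [Algebra ℂ R₁]
    [Ring R₂] [StarRing R₂] [Algebra ℂ R₂]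
    (T₁ : Submodule ℂ R₁) (T₂ : Submodule ℂ R₂) (ψ : ↥T₁ →ₗ[ℂ] ↥T₂) : Prop :=
  ∀ (n : ℕ) (M : Matrix (Fin n) (Fin n) ↥T₁),
    (∃ x : Matrix (Fin n) (Fin n) R₁, M.map Subtype.val = star x * x) →
    ∃ y : Matrix (Fin n) (Fin n) R₂, M.map (fun s => ((ψ s : ↥T₂) : R₂)) = star y * y

/-- A local boundary ideal for a local operator system `S ⊆ A`: a closed two-sided *-ideal such
that the quotient map is completely isometric on `S` with respect to the quotient matrix
seminorms. -/
def IsLocBdryIdeal {Λ A : Type*} [Ring A] [StarRing A] [Algebra ℂ A] [TopologicalSpace A]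
    (pn : Λ → ∀ n : ℕ, Matrix (Fin n) (Fin n) A → ℝ) (S : Submodule ℂ A)
    (I : Set A) : Prop :=
  (∃ J : TwoSidedIdeal A, (J : Set A) = I) ∧ (∀ a ∈ I, star a ∈ I) ∧ IsClosed I ∧
  ∀ (l : Λ) (n : ℕ) (M : Matrix (Fin n) (Fin n) ↥S),
    sInf {r : ℝ | ∃ C : Matrix (Fin n) (Fin n) A, (∀ i j, C i j ∈ I) ∧
        r = pn l n (M.map Subtype.val + C)} = pn l n (M.map Subtype.val)

open scoped InnerProductSpace

section GNS

open UniformSpace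

/-- The double sum `∑ᵢⱼ gᵢⱼ(rᵢ* sⱼ)` attached to a kernel of linear functionals. -/
noncomputable def kernelForm {ι B : Type*} [CStarAlgebra B] (g : ι → ι → B →ₗ[ℂ] ℂ)
    (r s : ι →₀ B) : ℂ :=
  r.sum fun i a => s.sum fun j b => g i j (star a * b)

/-- The space of finitely supported rows, to be equipped with the semi-inner product of a
positive definite kernel of functionals. -/
def KernelSpace {ι B : Type*} [CStarAlgebra B] (g : ι → ι → B →ₗ[ℂ] ℂ)
    (_ : ∀ i j b, g i j (star b) = star (g j i b)) (_ : ∀ r, 0 ≤ kernelForm g r r) : Type _ :=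
  ι →₀ B

section Kernel

variable {ι B : Type*} [CStarAlgebra B] {g : ι → ι → B →ₗ[ℂ] ℂ}

lemma kernelForm_add_left (r r' s : ι →₀ B) :
    kernelForm g (r + r') s = kernelForm g r s + kernelForm g r' s := by
  classical
  refine Finsupp.sum_add_index' (by simp) fun i a b => ?_
  simp [add_mul, Finsupp.sum_add]

lemma kernelForm_smul_left (c : ℂ) (r s : ι →₀ B) :
    kernelForm g (c • r) s = star c * kernelForm g r s := by
  rw [kernelForm, Finsupp.sum_smul_index' (by simp), kernelForm, Finsupp.mul_sum]
  simp [Finsupp.mul_sum]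

lemma kernelForm_single (i j : ι) (a b : B) :
    kernelForm g (Finsupp.single i a) (Finsupp.single j b) = g i j (star a * b) := by
  simp [kernelForm]

lemma star_kernelForm (hg : ∀ i j b, g i j (star b) = star (g j i b)) (r s : ι →₀ B) :
    star (kernelForm g r s) = kernelForm g s r := by
  simp only [kernelForm, Finsupp.sum, star_sum]
  rw [Finset.sum_comm]
  refine Finset.sum_congr rfl fun i _ => Finset.sum_congr rfl fun j _ => ?_
  rw [← hg]
  simp

lemma kernelForm_smul_right (a : B) (r s : ι →₀ B) :
    kernelForm g r (a • s) = kernelForm g (star a • r) s := by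
  rw [kernelForm, kernelForm, Finsupp.sum_smul_index' (by simp)]
  refine Finsupp.sum_congr fun i _ => ?_
  rw [Finsupp.sum_smul_index' (by simp)]
  simp [mul_assoc]

lemma kernelForm_smul_smul_le (hpos : ∀ r, 0 ≤ kernelForm g r r)
    (a : B) (r : ι →₀ B) :
    (kernelForm g (a • r) (a • r)).re ≤ ‖a‖ ^ 2 * (kernelForm g r r).re := by
  let _ := CStarAlgebra.spectralOrder B
  let _ := CStarAlgebra.spectralOrderedRing B
  have h : 0 ≤ algebraMap ℝ B (‖a‖ ^ 2) - star a * a := by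
    rw [sub_nonneg, sq, ← CStarRing.norm_star_mul_self]
    exact IsSelfAdjoint.le_algebraMap_norm_self (.star_mul_self a)
  obtain ⟨d, hd⟩ := CStarAlgebra.nonneg_iff_eq_star_mul_self.1 h
  have h1 := hpos (d • r)
  rw [kernelForm_smul_right, smul_smul, ← hd, sub_smul] at h1
  have h2 : kernelForm g (algebraMap ℝ B (‖a‖ ^ 2) • r - (star a * a) • r) r
      = (‖a‖ ^ 2 : ℝ) * kernelForm g r r - kernelForm g (a • r) (a • r) := by
    rw [kernelForm_smul_right a, smul_smul, eq_sub_iff_add_eq, ← kernelForm_add_left,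
      sub_add_cancel]
    have : algebraMap ℝ B (‖a‖ ^ 2) • r = ((‖a‖ ^ 2 : ℝ) : ℂ) • r := by
      ext i
      rw [Complex.coe_smul, Finsupp.smul_apply, Finsupp.smul_apply, smul_eq_mul,
        Algebra.algebraMap_eq_smul_one, smul_one_mul]
    rw [this, kernelForm_smul_left]
    simp
  rw [h2] at h1
  have := (Complex.le_def.1 h1).1
  simp only [Complex.zero_re, Complex.sub_re, Complex.re_ofReal_mul] at this
  linarith

namespace KernelSpace

variable {hg : ∀ i j b, g i j (star b) = star (g j i b)} {hpos : ∀ r, 0 ≤ kernelForm g r r}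

noncomputable instance : AddCommGroup (KernelSpace g hg hpos) :=
  inferInstanceAs (AddCommGroup (ι →₀ B))
noncomputable instance : Module ℂ (KernelSpace g hg hpos) :=
  inferInstanceAs (Module ℂ (ι →₀ B))

variable (hg hpos) in
/-- Finitely supported rows as elements of the kernel space. -/
noncomputable def ofRow : (ι →₀ B) ≃ₗ[ℂ] KernelSpace g hg hpos := LinearEquiv.refl ℂ _

/-- The semi-inner product of the kernel space. -/
noncomputable abbrev core : PreInnerProductSpace.Core ℂ (KernelSpace g hg hpos) where
  inner r s := kernelForm g ((ofRow hg hpos).symm r) ((ofRow hg hpos).symm s)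
  conj_inner_symm _ _ := star_kernelForm hg _ _
  re_inner_nonneg _ := (Complex.le_def.1 (hpos _)).1
  add_left _ _ _ := kernelForm_add_left _ _ _
  smul_left _ _ _ := kernelForm_smul_left _ _ _

noncomputable instance : SeminormedAddCommGroup (KernelSpace g hg hpos) :=
  InnerProductSpace.Core.toSeminormedAddCommGroup (c := core)
noncomputable instance : InnerProductSpace ℂ (KernelSpace g hg hpos) :=
  InnerProductSpace.ofCore core

lemma inner_ofRow (r s : ι →₀ B) : ⟪ofRow hg hpos r, ofRow hg hpos s⟫_ℂ = kernelForm g r s := rfl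

/-- Left multiplication on the kernel space. -/
noncomputable def leftMul (a : B) : KernelSpace g hg hpos →L[ℂ] KernelSpace g hg hpos :=
  ((ofRow hg hpos).toLinearMap ∘ₗ Algebra.lsmul ℂ ℂ (ι →₀ B) a ∘ₗ
    (ofRow hg hpos).symm.toLinearMap).mkContinuous ‖a‖ fun r => by
      obtain ⟨r, rfl⟩ := (ofRow hg hpos).surjective r
      have h := kernelForm_smul_smul_le hpos a r
      have h' (s : ι →₀ B) : (kernelForm g s s).re = ‖ofRow hg hpos s‖ ^ 2 :=
        inner_self_eq_norm_sq (𝕜 := ℂ) (ofRow hg hpos s)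
      rw [h', h', ← mul_pow] at h
      exact (sq_le_sq₀ (norm_nonneg _) (by positivity)).1 h

lemma leftMul_ofRow (a : B) (r : ι →₀ B) :
    leftMul a (ofRow hg hpos r) = ofRow hg hpos (a • r) := rfl

/-- The representation of the algebra on the completion of the kernel space. -/
noncomputable def rep : B →⋆ₐ[ℂ]
    (Completion (KernelSpace g hg hpos) →L[ℂ] Completion (KernelSpace g hg hpos)) where
  toFun a := (leftMul a).completion
  map_one' := by
    ext c
    induction c using Completion.induction_on with
    | hp => apply isClosed_eq <;> fun_prop
    | ih c =>
      obtain ⟨r, rfl⟩ := (ofRow hg hpos).surjective c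
      simp [leftMul_ofRow]
  map_mul' a b := by
    ext c
    induction c using Completion.induction_on with
    | hp => apply isClosed_eq <;> fun_prop
    | ih c =>
      obtain ⟨r, rfl⟩ := (ofRow hg hpos).surjective c
      simp [leftMul_ofRow, mul_smul]
  map_zero' := by
    ext c
    induction c using Completion.induction_on with
    | hp => apply isClosed_eq <;> fun_prop
    | ih c =>
      obtain ⟨r, rfl⟩ := (ofRow hg hpos).surjective c
      simp [leftMul_ofRow, Completion.coe_zero]
  map_add' a b := by
    ext c
    induction c using Completion.induction_on with
    | hp => apply isClosed_eq <;> fun_prop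
    | ih c =>
      obtain ⟨r, rfl⟩ := (ofRow hg hpos).surjective c
      simp [leftMul_ofRow, add_smul, Completion.coe_add]
  commutes' z := by
    ext c
    induction c using Completion.induction_on with
    | hp => apply isClosed_eq <;> fun_prop
    | ih c =>
      obtain ⟨r, rfl⟩ := (ofRow hg hpos).surjective c
      simp [leftMul_ofRow, Algebra.algebraMap_eq_smul_one, Completion.coe_smul]
  map_star' a := by
    refine (ContinuousLinearMap.eq_adjoint_iff _ _).2 fun x y => ?_
    induction x, y using Completion.induction_on₂ with
    | hp => apply isClosed_eq <;> fun_prop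
    | ih x y =>
      obtain ⟨r, rfl⟩ := (ofRow hg hpos).surjective x
      obtain ⟨s, rfl⟩ := (ofRow hg hpos).surjective y
      simp [leftMul_ofRow, inner_ofRow, kernelForm_smul_right]

lemma rep_ofRow (a : B) (r : ι →₀ B) :
    rep a (ofRow hg hpos r : Completion (KernelSpace g hg hpos)) = ofRow hg hpos (a • r) := by
  simp [rep, leftMul_ofRow]

end KernelSpace

/-- A positive definite kernel of functionals on a C*-algebra is implemented by vectors in a
representation, which may be chosen cyclic for these vectors. -/
theorem exists_rep_of_kernel.{u, v} {ι : Type u} {B : Type v} [CStarAlgebra B]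
    (g : ι → ι → B →ₗ[ℂ] ℂ) (hg : ∀ i j b, g i j (star b) = star (g j i b))
    (hpos : ∀ r, 0 ≤ kernelForm g r r) :
    ∃ (K : Type (max u v)) (_ : NormedAddCommGroup K) (_ : InnerProductSpace ℂ K)
      (_ : CompleteSpace K)
      (ρ : B →⋆ₐ[ℂ] (K →L[ℂ] K)) (x : ι → K),
      (∀ i j b, ⟪x i, ρ b (x j)⟫_ℂ = g i j b) ∧
      Dense (Submodule.span ℂ {y | ∃ b i, y = ρ b (x i)} : Set K) := by
  classical
  refine ⟨Completion (KernelSpace g hg hpos), inferInstance, inferInstance, inferInstance,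
    KernelSpace.rep, fun i => (KernelSpace.ofRow hg hpos (Finsupp.single i 1) :), ?_, ?_⟩
  · intro i j b
    rw [KernelSpace.rep_ofRow, Completion.inner_coe, KernelSpace.inner_ofRow]
    simp [kernelForm_single]
  · refine Completion.denseRange_coe.mono ?_
    rintro _ ⟨r, rfl⟩
    obtain ⟨r, rfl⟩ := (KernelSpace.ofRow hg hpos).surjective r
    induction r using Finsupp.induction_linear with
    | zero => rw [map_zero, Completion.coe_zero]; exact zero_mem _
    | add f g hf hg =>
      rw [map_add, Completion.coe_add]
      exact add_mem hf hg
    | single i b =>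
      refine Submodule.subset_span ⟨b, i, ?_⟩
      rw [KernelSpace.rep_ofRow]
      simp

end Kernel

lemma StarAlgHom.continuous_toCLM {B K : Type*} [CStarAlgebra B] [NormedAddCommGroup K]
    [InnerProductSpace ℂ K] [CompleteSpace K] (ρ : B →⋆ₐ[ℂ] (K →L[ℂ] K)) : Continuous ρ :=
  AddMonoidHomClass.continuous_of_bound ρ 1 fun b => by
    simpa using NonUnitalStarAlgHom.norm_apply_le ρ b

lemma Orthonormal.countable {𝕜 E ι : Type*} [RCLike 𝕜] [NormedAddCommGroup E]
    [InnerProductSpace 𝕜 E] [TopologicalSpace.SeparableSpace E] {v : ι → E}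
    (hv : Orthonormal 𝕜 v) : Countable ι := by
  refine Pairwise.countable_of_isOpen_disjoint (s := fun i => Metric.ball (v i) (1 / 2)) ?_
    (fun _ => Metric.isOpen_ball) fun i => ⟨v i, Metric.mem_ball_self (by norm_num)⟩
  intro i j hij
  refine Metric.ball_disjoint_ball ?_
  have h : ‖v i - v j‖ ^ 2 = 2 := by
    rw [@norm_sub_sq 𝕜, hv.2 hij, hv.1 i, hv.1 j]
    norm_num
  rw [dist_eq_norm]
  nlinarith [norm_nonneg (v i - v j)]

/-- A separable Hilbert space is isometric to one in the lowest universe. -/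
lemma exists_linearIsometryEquiv_type_zero (E : Type*) [NormedAddCommGroup E]
    [InnerProductSpace ℂ E] [CompleteSpace E] [TopologicalSpace.SeparableSpace E] :
    ∃ (K : Type) (_ : NormedAddCommGroup K) (_ : InnerProductSpace ℂ K) (_ : CompleteSpace K),
      Nonempty (E ≃ₗᵢ[ℂ] K) := by
  obtain ⟨w, b, -⟩ := exists_hilbertBasis ℂ E
  have := b.orthonormal.countable
  obtain ⟨f, hf⟩ := exists_injective_nat w
  let e := Equiv.ofInjective f hf
  refine ⟨lp (fun _ : Set.range f => ℂ) 2, inferInstance, inferInstance, inferInstance,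
    ⟨(HilbertBasis.mk (v := b ∘ e.symm)
    (b.orthonormal.comp _ e.symm.injective) ?_).repr⟩⟩
  rw [e.symm.surjective.range_comp, b.dense_span]

/-- Over a separable C*-algebra and for countably many vectors, the representation of
`exists_rep_of_kernel` may be realised in the lowest universe. -/
theorem exists_rep_of_kernel_type_zero {ι B : Type*} [Countable ι] [CStarAlgebra B]
    [TopologicalSpace.SeparableSpace B] (g : ι → ι → B →ₗ[ℂ] ℂ)
    (hg : ∀ i j b, g i j (star b) = star (g j i b)) (hpos : ∀ r, 0 ≤ kernelForm g r r) :
    ∃ (K : Type) (_ : NormedAddCommGroup K) (_ : InnerProductSpace ℂ K) (_ : CompleteSpace K)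
      (ρ : B →⋆ₐ[ℂ] (K →L[ℂ] K)) (x : ι → K),
      (∀ i j b, ⟪x i, ρ b (x j)⟫_ℂ = g i j b) ∧
      Dense (Submodule.span ℂ {y | ∃ b i, y = ρ b (x i)} : Set K) := by
  obtain ⟨K, _, _, _, ρ, x, hx, hd⟩ := exists_rep_of_kernel g hg hpos
  have hsep : TopologicalSpace.IsSeparable {y | ∃ b i, y = ρ b (x i)} := by
    have : {y | ∃ b i, y = ρ b (x i)} = ⋃ i, Set.range fun b => ρ b (x i) := by
      ext y
      simp only [Set.mem_ofPred_eq, Set.mem_iUnion, Set.mem_range, eq_comm (a := y)]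
      exact exists_comm
    rw [this]
    refine .iUnion fun i => TopologicalSpace.isSeparable_range ?_
    have : Continuous ρ := ρ.continuous_toCLM
    fun_prop
  have : TopologicalSpace.SeparableSpace K := by
    rw [← TopologicalSpace.isSeparable_univ_iff, ← hd.closure_eq]
    exact (hsep.span (R := ℂ)).closure
  obtain ⟨K', _, _, _, ⟨U⟩⟩ := exists_linearIsometryEquiv_type_zero K
  refine ⟨K', inferInstance, inferInstance, inferInstance,
    (StarAlgHomClass.toStarAlgHom U.conjStarAlgEquiv).comp ρ, fun i => U (x i), ?_, ?_⟩
  · intro i j b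
    rw [← hx, ← U.inner_map_map]
    simp
  · have h := U.surjective.denseRange.dense_image U.continuous hd
    rw [← LinearIsometryEquiv.coe_toLinearEquiv, ← LinearEquiv.coe_coe, ← Submodule.map_coe,
      Submodule.map_span] at h
    refine h.mono (Submodule.span_mono ?_)
    rintro _ ⟨_, ⟨b, i, rfl⟩, rfl⟩
    exact ⟨b, i, by simp⟩

end GNS

/-- A compact convex-type set has an extreme point which successively maximises a given sequence
of continuous functionals in lexicographic order. -/
theorem exists_extremePoint_lexicographic_max {E : Type*} [AddCommGroup E] [Module ℝ E]
    [TopologicalSpace E] [T2Space E] [IsTopologicalAddGroup E] [ContinuousSMul ℝ E]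
    [LocallyConvexSpace ℝ E] {K : Set E} (hK : IsCompact K) (hne : K.Nonempty)
    (L : ℕ → StrongDual ℝ E) :
    ∃ g ∈ K.extremePoints ℝ, ∀ n, ∀ g' ∈ K, (∀ k < n, L k g' = L k g) → L n g' ≤ L n g := by
  let F : ℕ → Set E := Nat.rec K fun n F => (L n).toExposed F
  have hsucc (n) : F (n + 1) = (L n).toExposed (F n) := rfl
  have hsub (n) : F (n + 1) ⊆ F n := fun x hx => hx.1
  have hF (n) : IsCompact (F n) ∧ (F n).Nonempty ∧ IsExtreme ℝ K (F n) := by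
    induction n with
    | zero => exact ⟨hK, hne, .rfl⟩
    | succ n ih =>
      obtain ⟨hc, hn, he⟩ := ih
      have hexp : IsExposed ℝ (F n) (F (n + 1)) := ContinuousLinearMap.toExposed.isExposed
      refine ⟨hexp.isCompact hc, ?_, he.trans hexp.isExtreme⟩
      obtain ⟨x, hx, hmax⟩ := hc.exists_isMaxOn hn (L n).continuous.continuousOn
      exact ⟨x, hx, fun y hy => hmax hy⟩
  have hFne : (⋂ n, F n).Nonempty :=
    IsCompact.nonempty_iInter_of_sequence_nonempty_isCompact_isClosed F hsub (fun n => (hF n).2.1)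
      hK fun n => (hF n).1.isClosed
  have hext : IsExtreme ℝ K (⋂ n, F n) := isExtreme_iInter fun n => (hF n).2.2
  have hcomp : IsCompact (⋂ n, F n) :=
    hK.of_isClosed_subset (isClosed_iInter fun n => (hF n).1.isClosed) (Set.iInter_subset F 0)
  obtain ⟨g, hg⟩ := hcomp.extremePoints_nonempty hFne
  refine ⟨g, hext.extremePoints_subset_extremePoints hg, fun n g' hg' heq => ?_⟩
  have hgF := Set.mem_iInter.1 hg.1
  have hmem (m) (hm : m ≤ n) : g' ∈ F m := by
    induction m with
    | zero => exact hg'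
    | succ m ih =>
      refine ⟨ih (by lia), fun y hy => ?_⟩
      rw [heq m hm]
      exact (hgF (m + 1)).2 y hy
  exact (hgF (n + 1)).2 g' (hmem n le_rfl)

/-- The set of states of a unital C*-algebra, as a set of functions. -/
def stateSet (D : Type*) [CStarAlgebra D] : Set (D → ℂ) :=
  {f | (∀ x y, f (x + y) = f x + f y) ∧ (∀ (c : ℂ) x, f (c • x) = c * f x) ∧ f 1 = 1 ∧
    ∀ y, 0 ≤ f (star y * y)}

lemma coe_mem_stateSet {D : Type*} [CStarAlgebra D] {f : D →ₗ[ℂ] ℂ} (h1 : f 1 = 1)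
    (hf : ∀ y, 0 ≤ f (star y * y)) : ⇑f ∈ stateSet D :=
  ⟨map_add f, map_smul f, h1, hf⟩

lemma exists_linearMap_of_mem_stateSet {D : Type*} [CStarAlgebra D] {f : D → ℂ}
    (hf : f ∈ stateSet D) : ∃ φ : D →ₗ[ℂ] ℂ, ⇑φ = f :=
  ⟨⟨⟨f, hf.1⟩, hf.2.1⟩, rfl⟩

section States

variable {D : Type*} [CStarAlgebra D] [PartialOrder D] [StarOrderedRing D]

lemma LinearMap.map_star_of_nonneg {f : D →ₗ[ℂ] ℂ} (hf : ∀ y, 0 ≤ f (star y * y)) (y : D) :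
    f (star y) = star (f y) := by
  have hf' (y) (hy : 0 ≤ y) : 0 ≤ f y := by
    obtain ⟨z, rfl⟩ := CStarAlgebra.nonneg_iff_eq_star_mul_self.1 hy
    exact hf z
  exact map_star (PositiveLinearMap.mk₀ f hf') y

lemma LinearMap.norm_apply_le_of_nonneg {f : D →ₗ[ℂ] ℂ} (hf : ∀ y, 0 ≤ f (star y * y)) (y : D) :
    ‖f y‖ ≤ (f 1).re * ‖y‖ := by
  have hf' (y) (hy : 0 ≤ y) : 0 ≤ f y := by
    obtain ⟨z, rfl⟩ := CStarAlgebra.nonneg_iff_eq_star_mul_self.1 hy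
    exact hf z
  let F := PositiveLinearMap.mk₀ f hf'
  have h1 : f y = ⟪F.toPreGNS 1, F.leftMulMapPreGNS y (F.toPreGNS 1)⟫_ℂ := by
    rw [PositiveLinearMap.preGNS_inner_def]
    change f y = f (star 1 * (y * 1))
    simp
  have h2 : ‖F.toPreGNS 1‖ ^ 2 = (f 1).re := by
    have h := F.preGNS_norm_sq (F.toPreGNS 1)
    have h' : F (star (F.ofPreGNS (F.toPreGNS 1)) * F.ofPreGNS (F.toPreGNS 1)) = f (star 1 * 1) :=
      rfl
    rw [h', star_one, one_mul] at h
    rw [← h, ← Complex.ofReal_pow, Complex.ofReal_re]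
  calc ‖f y‖ ≤ ‖F.toPreGNS 1‖ * ‖F.leftMulMapPreGNS y (F.toPreGNS 1)‖ := by
        rw [h1]; exact norm_inner_le_norm _ _
    _ ≤ ‖F.toPreGNS 1‖ * (‖y‖ * ‖F.toPreGNS 1‖) := by
        gcongr
        refine ((F.leftMulMapPreGNS y).le_opNorm _).trans ?_
        gcongr
        exact LinearMap.mkContinuous_norm_le _ (norm_nonneg _) _
    _ = _ := by rw [← h2]; ring

lemma isCompact_stateSet : IsCompact (stateSet D) := by
  refine (isCompact_univ_pi fun y : D => isCompact_closedBall (0 : ℂ) ‖y‖).of_isClosed_subset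
    ?_ ?_
  · simp only [stateSet, Set.ofPred_and, Set.ofPred_forall]
    refine .inter ?_ (.inter ?_ (.inter ?_ ?_))
    · exact isClosed_iInter fun x => isClosed_iInter fun y =>
        isClosed_eq (by fun_prop) (by fun_prop)
    · exact isClosed_iInter fun x => isClosed_iInter fun y =>
        isClosed_eq (by fun_prop) (by fun_prop)
    · exact isClosed_eq (by fun_prop) (by fun_prop)
    · exact isClosed_iInter fun y => isClosed_le (by fun_prop) (by fun_prop)
  · intro f hf y _
    obtain ⟨φ, rfl⟩ := exists_linearMap_of_mem_stateSet hf
    simpa [hf.2.2.1] using LinearMap.norm_apply_le_of_nonneg hf.2.2.2 y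

lemma norm_algebraMap_norm_sub_le {z : D} (hz : 0 ≤ z) : ‖algebraMap ℝ D ‖z‖ - z‖ ≤ ‖z‖ := by
  have h : 0 ≤ algebraMap ℝ D ‖z‖ - z :=
    sub_nonneg.2 (IsSelfAdjoint.le_algebraMap_norm_self (.of_nonneg hz))
  exact (CStarAlgebra.norm_le_iff_le_algebraMap _ (norm_nonneg z)).2 (sub_le_self _ hz)

lemma nonneg_of_norm_algebraMap_sub_le {z : D} (hz : IsSelfAdjoint z) {t : ℝ}
    (h : ‖algebraMap ℝ D t - z‖ ≤ t) : 0 ≤ z := by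
  have h1 : algebraMap ℝ D t - z ≤ algebraMap ℝ D ‖algebraMap ℝ D t - z‖ :=
    IsSelfAdjoint.le_algebraMap_norm_self ((IsSelfAdjoint.algebraMap D (.all t)).sub hz)
  simpa using h1.trans (algebraMap_mono D h)

/-- A contractive unital functional is positive. -/
lemma nonneg_of_norm_le {f : D →ₗ[ℂ] ℂ} (h1 : f 1 = 1) (hf : ∀ y, ‖f y‖ ≤ ‖y‖) (y : D) :
    0 ≤ f (star y * y) := by
  have : Nontrivial D := ⟨1, 0, fun h => by simp [h] at h1⟩
  have hsa (h : D) (hh : IsSelfAdjoint h) : (f h).im = 0 := by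
    by_contra hne
    have key (t : ℝ) : ((f h).im + t) ^ 2 ≤ ‖h‖ ^ 2 + t ^ 2 := by
      have e : ‖h + (t * Complex.I) • 1‖ ^ 2 ≤ ‖h‖ ^ 2 + t ^ 2 := by
        rw [sq, ← CStarRing.norm_star_mul_self]
        have : star (h + (t * Complex.I) • 1) * (h + (t * Complex.I) • 1)
            = star h * h + algebraMap ℝ D (t ^ 2) := by
          have hI : star ((t * Complex.I) • (1 : D)) = -((t * Complex.I) • 1) := by
            simp [star_smul]
          have hsq : ((t * Complex.I) • (1 : D)) * ((t * Complex.I) • 1)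
              = -algebraMap ℝ D (t ^ 2) := by
            rw [smul_mul_smul_comm, one_mul, Algebra.algebraMap_eq_smul_one, ← Complex.coe_smul,
              ← neg_smul]
            congr 1
            push_cast
            linear_combination (t : ℂ) ^ 2 * Complex.I_sq
          rw [star_add, hI, add_mul, mul_add, mul_add, neg_mul, neg_mul, hsq, neg_neg,
            hh.star_eq, mul_smul_one, smul_one_mul]
          abel
        rw [this]
        refine (norm_add_le _ _).trans ?_
        rw [CStarRing.norm_star_mul_self, ← sq]
        gcongr
        exact (norm_algebraMap' D (t ^ 2)).le.trans (by simp)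
      have h3 := hf (h + (t * Complex.I) • 1)
      have h4 := Complex.abs_im_le_norm (f (h + (t * Complex.I) • 1))
      have h5 : (f (h + (t * Complex.I) • 1)).im = (f h).im + t := by simp [h1]
      rw [h5] at h4
      calc ((f h).im + t) ^ 2 = |(f h).im + t| ^ 2 := (sq_abs _).symm
        _ ≤ ‖h + (t * Complex.I) • 1‖ ^ 2 := by gcongr; exact h4.trans h3
        _ ≤ _ := e
    have := key ((‖h‖ ^ 2 + 1) / (f h).im)
    have h6 : (f h).im * ((‖h‖ ^ 2 + 1) / (f h).im) = ‖h‖ ^ 2 + 1 := by field_simp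
    nlinarith [sq_nonneg (f h).im, sq_nonneg ‖h‖]
  set z := star y * y with hz
  have hz0 : 0 ≤ z := star_mul_self_nonneg y
  refine Complex.le_def.2 ⟨?_, (hsa z (.star_mul_self y)).symm⟩
  have h7 := norm_algebraMap_norm_sub_le hz0
  have h8 := (Complex.re_le_norm _).trans ((hf _).trans h7)
  rw [map_sub, Algebra.algebraMap_eq_smul_one, ← Complex.coe_smul, map_smul, h1] at h8
  simpa using h8

lemma exists_mem_stateSet_apply_eq_norm {a : D} (ha : 0 ≤ a) (h0 : a ≠ 0) :
    ∃ g ∈ stateSet D, g a = ‖a‖ := by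
  have hn : 0 < ‖a‖ := norm_pos_iff.2 h0
  have : Nontrivial D := ⟨a, 0, h0⟩
  set w := algebraMap ℝ D ‖a‖ + a with hw
  have haw : a ≤ w := le_add_of_nonneg_left (by
    simpa using algebraMap_mono D (norm_nonneg a))
  have hw0 : 0 ≤ w := ha.trans haw
  have hnw : ‖a‖ ≤ ‖w‖ := CStarAlgebra.norm_le_norm_of_nonneg_of_le ha haw
  have hw2 : 2 * ‖a‖ ≤ ‖w‖ := by
    have h : a ≤ algebraMap ℝ D (‖w‖ - ‖a‖) := by
      rw [map_sub, le_sub_iff_add_le, add_comm]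
      exact IsSelfAdjoint.le_algebraMap_norm_self (.of_nonneg hw0)
    have := (CStarAlgebra.norm_le_iff_le_algebraMap a (sub_nonneg.2 hnw)).2 h
    linarith
  obtain ⟨g, hg, hgw⟩ := exists_dual_vector ℂ w (hn.trans_le hnw).ne'
  have hb (y) : ‖g y‖ ≤ ‖y‖ := by simpa [hg] using g.le_opNorm y
  have hg1 : ‖g 1‖ ≤ 1 := by simpa using hb 1
  have hdec : (‖a‖ : ℂ) * g 1 + g a = ‖w‖ := by
    have hgw' : g w = (‖w‖ : ℂ) := hgw
    rw [← hgw', hw, map_add,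
      Algebra.algebraMap_eq_smul_one, ← Complex.coe_smul, map_smul]
    simp
  have hre : (g 1).re = 1 := by
    have h := congrArg Complex.re hdec
    simp only [Complex.add_re, Complex.re_ofReal_mul, Complex.ofReal_re] at h
    have h1 := (Complex.re_le_norm (g a)).trans (hb a)
    have h2 := (Complex.re_le_norm (g 1)).trans hg1
    nlinarith
  have hone : g 1 = 1 := by
    have h := Complex.sq_norm_sub_sq_re (g 1)
    refine Complex.ext (by simpa using hre) ?_
    rw [hre] at h
    have : ‖g 1‖ ^ 2 ≤ 1 := pow_le_one₀ (norm_nonneg _) hg1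
    simp only [Complex.one_im]
    nlinarith
  have hpos := nonneg_of_norm_le (f := (g : D →ₗ[ℂ] ℂ)) hone hb
  refine ⟨g, coe_mem_stateSet (f := (g : D →ₗ[ℂ] ℂ)) hone hpos, ?_⟩
  have h1 : (g a).re = ‖w‖ - ‖a‖ := by
    rw [hone, mul_one] at hdec
    have := congrArg Complex.re hdec
    simp only [Complex.add_re, Complex.ofReal_re] at this
    linarith
  have h2 : g a = ‖w‖ - ‖a‖ := by
    rw [← hdec, hone]; ring
  have h3 : ‖w‖ - ‖a‖ ≤ ‖a‖ := h1 ▸ (Complex.re_le_norm (g a)).trans (hb a)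
  rw [h2, ← Complex.ofReal_sub]
  congr 1
  linarith

end States

section VecFunctional

variable {ι B K : Type*} [Fintype ι] [NormedAddCommGroup K] [InnerProductSpace ℂ K]

lemma sum_inner_star_mul_self [CompleteSpace K] (X : Matrix ι ι (K →L[ℂ] K)) (x : ι → K) :
    ∑ i, ∑ j, ⟪x i, (star X * X) i j (x j)⟫_ℂ = ∑ k, (‖∑ j, X k j (x j)‖ ^ 2 : ℂ) := by
  have h (k) : (‖∑ j, X k j (x j)‖ ^ 2 : ℂ) = ∑ i, ∑ j, ⟪X k i (x i), X k j (x j)⟫_ℂ := by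
    refine (inner_self_eq_norm_sq_to_K (𝕜 := ℂ) (∑ j, X k j (x j))).symm.trans ?_
    simp only [sum_inner, inner_sum]
    exact Finset.sum_comm
  have h' (i j) : ⟪x i, (star X * X) i j (x j)⟫_ℂ = ∑ k, ⟪X k i (x i), X k j (x j)⟫_ℂ := by
    simp [Matrix.mul_apply, Matrix.star_apply, ContinuousLinearMap.star_eq_adjoint,
      ContinuousLinearMap.adjoint_inner_right]
  simp only [h, h']
  rw [Finset.sum_comm_cycle]

variable [CStarAlgebra B]

/-- The functional `D ↦ ∑ᵢⱼ ⟪xᵢ, χ(Dᵢⱼ) xⱼ⟫` on a matrix algebra. -/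
noncomputable def vecFunctional (χ : B →ₗ[ℂ] (K →L[ℂ] K)) (x : ι → K) :
    CStarMatrix ι ι B →ₗ[ℂ] ℂ where
  toFun D := ∑ i, ∑ j, ⟪x i, χ (D i j) (x j)⟫_ℂ
  map_add' D D' := by simp [Finset.sum_add_distrib]
  map_smul' c D := by simp [Finset.mul_sum]

lemma vecFunctional_apply (χ : B →ₗ[ℂ] (K →L[ℂ] K)) (x : ι → K) (D : CStarMatrix ι ι B) :
    vecFunctional χ x D = ∑ i, ∑ j, ⟪x i, χ (D i j) (x j)⟫_ℂ := rfl

lemma vecFunctional_one [DecidableEq ι] {χ : B →ₗ[ℂ] (K →L[ℂ] K)} (h1 : χ 1 = 1) (x : ι → K) :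
    vecFunctional χ x 1 = ∑ i, (‖x i‖ ^ 2 : ℂ) := by
  rw [vecFunctional_apply]
  refine Finset.sum_congr rfl fun i _ => ?_
  rw [Finset.sum_eq_single i]
  · simp [h1]
  · intro j _ hj
    simp [hj.symm]
  · simp

lemma vecFunctional_diagonal [DecidableEq ι] (χ : B →ₗ[ℂ] (K →L[ℂ] K)) (x : ι → K) (b : B) :
    vecFunctional χ x (CStarMatrix.ofMatrix (Matrix.diagonal fun _ => b))
      = ∑ i, ⟪x i, χ b (x i)⟫_ℂ := by
  rw [vecFunctional_apply]
  refine Finset.sum_congr rfl fun i _ => ?_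
  rw [Finset.sum_eq_single i]
  · simp
  · intro j _ hj
    simp [hj.symm]
  · simp

lemma vecFunctional_star_mul_self [CompleteSpace K] (π : B →⋆ₐ[ℂ] (K →L[ℂ] K)) (x : ι → K)
    (D : CStarMatrix ι ι B) :
    vecFunctional (π : B →ₗ[ℂ] (K →L[ℂ] K)) x (star D * D)
      = ∑ k, (‖∑ j, π (D k j) (x j)‖ ^ 2 : ℂ) := by
  refine .trans ?_ (sum_inner_star_mul_self (.of fun i j => π (D i j)) x)
  rw [vecFunctional_apply]
  refine Finset.sum_congr rfl fun i _ => Finset.sum_congr rfl fun j _ => ?_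
  congr 2
  simp [CStarMatrix.mul_apply, Matrix.mul_apply, CStarMatrix.star_apply, Matrix.star_apply,
    map_star π]

lemma MatPosOp.sum_inner_nonneg [CompleteSpace K] {n : ℕ}
    {T : Matrix (Fin n) (Fin n) (K →L[ℂ] K)} (hT : MatPosOp T) (x : Fin n → K) :
    0 ≤ ∑ i, ∑ j, ⟪x i, T i j (x j)⟫_ℂ := by
  obtain ⟨X, rfl⟩ := hT
  rw [sum_inner_star_mul_self]
  exact Finset.sum_nonneg fun k _ => by positivity

lemma IsCstarCPmap.vecFunctional_nonneg [CompleteSpace K] {n : ℕ} {χ : B →ₗ[ℂ] (K →L[ℂ] K)}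
    (hχ : IsCstarCPmap χ) (x : Fin n → K) (D : CStarMatrix (Fin n) (Fin n) B) :
    0 ≤ vecFunctional χ x (star D * D) :=
  (hχ n _ ⟨CStarMatrix.ofMatrix.symm D, rfl⟩).sum_inner_nonneg x

/-- Stinespring-type factorisation along a row. -/
lemma IsCstarCPmap.exists_row_factorization [CompleteSpace K] {χ : B →ₗ[ℂ] (K →L[ℂ] K)}
    (hχ : IsCstarCPmap χ) (y : ι → B) :
    ∃ m : ℕ, ∃ W : ι → K →L[ℂ] PiLp 2 (fun _ : Fin m => K),
      ∀ i j u v, ⟪W i u, W j v⟫_ℂ = ⟪u, χ (star (y i) * y j) v⟫_ℂ := by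
  classical
  let e := Fintype.equivFin ι
  rcases isEmpty_or_nonempty ι with hι | ⟨⟨i₀⟩⟩
  · exact ⟨0, fun i => hι.elim i, fun i => hι.elim i⟩
  obtain ⟨X, hX⟩ := hχ (Fintype.card ι) (.of fun i j => star (y (e.symm i)) * y (e.symm j))
    ⟨.of fun k j => if k = e i₀ then y (e.symm j) else 0, by
      ext i j
      simp [Matrix.mul_apply, Matrix.star_apply, apply_ite star]⟩
  refine ⟨Fintype.card ι, fun i =>
    ((PiLp.continuousLinearEquiv 2 ℂ fun _ : Fin (Fintype.card ι) => K).symm :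
      (Fin (Fintype.card ι) → K) →L[ℂ] _) ∘L .pi fun k => X k (e i), fun i j u v => ?_⟩
  have := congrFun (congrFun hX (e i)) (e j)
  simp only [Matrix.map_apply, Matrix.of_apply, Equiv.symm_apply_apply] at this
  rw [this]
  simp [PiLp.inner_apply, Matrix.mul_apply, Matrix.star_apply,
    ContinuousLinearMap.star_eq_adjoint, ContinuousLinearMap.adjoint_inner_right]

end VecFunctional

/-- A positive functional on a matrix algebra comes from vectors in a representation. -/
theorem exists_eq_vecFunctional {n : ℕ} {B : Type*} [CStarAlgebra B] [PartialOrder B]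
    [StarOrderedRing B] [TopologicalSpace.SeparableSpace B]
    {f : CStarMatrix (Fin n) (Fin n) B →ₗ[ℂ] ℂ} (hf : ∀ y, 0 ≤ f (star y * y)) :
    ∃ (K : Type) (_ : NormedAddCommGroup K) (_ : InnerProductSpace ℂ K) (_ : CompleteSpace K)
      (π : B →⋆ₐ[ℂ] (K →L[ℂ] K)) (x : Fin n → K),
      vecFunctional (π : B →ₗ[ℂ] (K →L[ℂ] K)) x = f ∧
      Dense (Submodule.span ℂ {y | ∃ b i, y = π b (x i)} : Set K) := by
  let E (i j : Fin n) (b : B) : CStarMatrix (Fin n) (Fin n) B :=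
    CStarMatrix.ofMatrix (Matrix.single i j b)
  let g (i j : Fin n) : B →ₗ[ℂ] ℂ := f ∘ₗ
    { toFun := E i j
      map_add' := fun a b => by simp [E, Matrix.single_add]
      map_smul' := fun c a => by simp [E, ← Matrix.smul_single] }
  have hg (i j b) : g i j b = f (E i j b) := rfl
  obtain ⟨K, _, _, _, π, x, hx, hd⟩ := exists_rep_of_kernel_type_zero g (fun i j b => by
    rw [hg, hg, ← LinearMap.map_star_of_nonneg hf]
    congr 1
    ext k l
    simp [E, CStarMatrix.star_apply, Matrix.single_apply, apply_ite star, and_comm]) (fun r => by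
    have h : kernelForm g r r = f (∑ i, ∑ j, E i j (star (r i) * r j)) := by
      rw [kernelForm, Finsupp.sum_fintype _ _ (by simp), map_sum]
      refine Finset.sum_congr rfl fun i _ => ?_
      rw [Finsupp.sum_fintype _ _ (by simp), map_sum]
      rfl
    rw [h]
    rcases isEmpty_or_nonempty (Fin n) with h | ⟨⟨i₀⟩⟩
    · simp
    have h2 : ∑ i, ∑ j, E i j (star (r i) * r j)
        = CStarMatrix.ofMatrix (.of fun i j => star (r i) * r j) :=
      (Matrix.matrix_eq_sum_single (.of fun i j => star (r i) * r j)).symm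
    rw [h2]
    convert hf (CStarMatrix.ofMatrix (.of fun k j => if k = i₀ then r j else 0)) using 2
    ext k l
    simp [CStarMatrix.mul_apply, CStarMatrix.star_apply, apply_ite star])
  refine ⟨K, _, _, _, π, x, ?_, hd⟩
  ext D
  rw [vecFunctional_apply]
  simp only [LinearMap.coe_coe, hx, hg, ← map_sum]
  congr 1
  exact (Matrix.matrix_eq_sum_single (CStarMatrix.ofMatrix.symm D)).symm

section Extension

variable {n : ℕ} {B K : Type*} [NormedAddCommGroup K] [InnerProductSpace ℂ K] [CompleteSpace K]
  [CStarAlgebra B]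

lemma re_inner_star_mul_self (T : K →L[ℂ] K) (u : K) :
    (⟪u, (star T * T) u⟫_ℂ).re = ‖T u‖ ^ 2 := by
  have : ⟪u, (star T * T) u⟫_ℂ = ⟪T u, T u⟫_ℂ := by
    have h : (star T * T) u = star T (T u) := rfl
    rw [h, ContinuousLinearMap.star_eq_adjoint, ContinuousLinearMap.adjoint_inner_right]
  rw [this]
  exact inner_self_eq_norm_sq (𝕜 := ℂ) _

/-- The Schwarz inequality along a row for a unital completely positive map. -/
lemma IsCstarCPmap.sq_norm_row_le {χ : B →ₗ[ℂ] (K →L[ℂ] K)} (hχ : IsCstarCPmap χ)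
    (h1 : χ 1 = 1) (y : Fin n → B) (x : Fin n → K) :
    ‖∑ j, χ (y j) (x j)‖ ^ 2 ≤ (∑ i, ∑ j, ⟪x i, χ (star (y i) * y j) (x j)⟫_ℂ).re := by
  obtain ⟨m, W, hW⟩ := hχ.exists_row_factorization fun o : Option (Fin n) => o.elim 1 y
  set h := ∑ j, χ (y j) (x j) with hh
  set v := ∑ j, W (some j) (x j) with hv
  have e1 : ∑ i, ∑ j, ⟪x i, χ (star (y i) * y j) (x j)⟫_ℂ = ⟪v, v⟫_ℂ := by
    simp only [hv, sum_inner, inner_sum]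
    rw [Finset.sum_comm]
    simp [hW]
  have e2 : ⟪W none h, v⟫_ℂ = ⟪h, h⟫_ℂ := by
    calc ⟪W none h, v⟫_ℂ = ∑ j, ⟪h, χ (y j) (x j)⟫_ℂ := by
          simp only [hv, inner_sum]
          simp [hW]
      _ = ⟪h, h⟫_ℂ := (inner_sum _ _ _).symm
  have e3 : ⟪W none h, W none h⟫_ℂ = ⟪h, h⟫_ℂ := by
    rw [hW none none]
    simp only [Option.elim_none, star_one, one_mul, h1]
    rfl
  have e4 : ‖W none h‖ = ‖h‖ := by
    rw [@norm_eq_sqrt_re_inner ℂ, e3, ← @norm_eq_sqrt_re_inner ℂ]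
  rw [e1]
  have h5 : (⟪v, v⟫_ℂ).re = ‖v‖ ^ 2 := inner_self_eq_norm_sq (𝕜 := ℂ) v
  have h6 := inner_self_eq_norm_sq (𝕜 := ℂ) h
  have h7 := @norm_sub_sq ℂ _ _ _ _ (W none h) v
  rw [e2, h6, e4] at h7
  rw [h5]
  nlinarith [sq_nonneg ‖W none h - v‖]

/-- If a unital completely positive map attains equality in the Schwarz inequality at a vector,
then it is multiplicative there. -/
lemma IsCstarCPmap.apply_mul_of_inner_eq {χ : B →ₗ[ℂ] (K →L[ℂ] K)} (hχ : IsCstarCPmap χ)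
    (h1 : χ 1 = 1) {a : B} {u : K}
    (h : (⟪u, χ (star a * a) u⟫_ℂ).re ≤ ‖χ a u‖ ^ 2) (b : B) : χ (b * a) u = χ b (χ a u) := by
  obtain ⟨m, W, hW⟩ := hχ.exists_row_factorization ![a, 1, star b]
  have e : W 0 u = W 1 (χ a u) := by
    rw [← sub_eq_zero, ← norm_eq_zero, ← sq_eq_zero_iff]
    refine le_antisymm ?_ (sq_nonneg _)
    have h5 : (⟪W 0 u, W 0 u⟫_ℂ).re = ‖W 0 u‖ ^ 2 := inner_self_eq_norm_sq (𝕜 := ℂ) _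
    have h6 : (⟪W 1 (χ a u), W 1 (χ a u)⟫_ℂ).re = ‖W 1 (χ a u)‖ ^ 2 :=
      inner_self_eq_norm_sq (𝕜 := ℂ) _
    have h7 : (⟪χ a u, χ a u⟫_ℂ).re = ‖χ a u‖ ^ 2 := inner_self_eq_norm_sq (𝕜 := ℂ) _
    have h8 : ⟪W 1 (χ a u), W 0 u⟫_ℂ = ⟪χ a u, χ a u⟫_ℂ := by
      rw [hW 1 0]
      simp only [Matrix.cons_val_zero, Matrix.cons_val_one, star_one, one_mul]
    have h9 : ⟪W 1 (χ a u), W 1 (χ a u)⟫_ℂ = ⟪χ a u, χ a u⟫_ℂ := by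
      rw [hW 1 1]
      simp only [Matrix.cons_val_one, Matrix.cons_val_zero, star_one, one_mul, h1]
      rfl
    have h10 : ⟪W 0 u, W 0 u⟫_ℂ = ⟪u, χ (star a * a) u⟫_ℂ := hW 0 0 u u
    rw [norm_sub_rev, @norm_sub_sq ℂ, h8, ← h5, ← h6, h9, h10]
    change (⟪χ a u, χ a u⟫_ℂ).re - 2 * (⟪χ a u, χ a u⟫_ℂ).re + _ ≤ 0
    linarith
  refine ext_inner_left ℂ fun v => ?_
  have h2 := hW 2 0 v u
  have h3 := hW 2 1 v (χ a u)
  rw [e] at h2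
  simpa using h2.symm.trans h3

variable [PartialOrder B] [StarOrderedRing B]

/-- A vector functional which lexicographically maximises suitable words determines its
representation on the generating set. -/
theorem eq_of_lexicographic_max {S : Set B} {π : B →⋆ₐ[ℂ] (K →L[ℂ] K)} {x : Fin n → K}
    (hcyc : Dense (Submodule.span ℂ {y | ∃ b i, y = π b (x i)} : Set K))
    (hx1 : vecFunctional (π : B →ₗ[ℂ] (K →L[ℂ] K)) x 1 = 1)
    {M : CStarMatrix (Fin n) (Fin n) B} (hM : ∀ i j, M i j ∈ S) {w : ℕ → B}
    (hw : ∀ k, w k = 1 ∨ ∃ m < k, ∃ s ∈ S, w k = s * w m)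
    (hwd : Dense (Submodule.span ℂ (Set.range w) : Set B))
    (hmax₀ : ∀ f ∈ stateSet (CStarMatrix (Fin n) (Fin n) B),
      (f (star M * M)).re ≤ (vecFunctional (π : B →ₗ[ℂ] (K →L[ℂ] K)) x (star M * M)).re)
    (hmax : ∀ k, ∀ f ∈ stateSet (CStarMatrix (Fin n) (Fin n) B),
      (f (star M * M)).re = (vecFunctional (π : B →ₗ[ℂ] (K →L[ℂ] K)) x (star M * M)).re →
      (∀ m < k, (f (.ofMatrix (.diagonal fun _ => star (w m) * w m))).re =
        (vecFunctional (π : B →ₗ[ℂ] (K →L[ℂ] K)) x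
          (.ofMatrix (.diagonal fun _ => star (w m) * w m))).re) →
      (f (.ofMatrix (.diagonal fun _ => star (w k) * w k))).re ≤
        (vecFunctional (π : B →ₗ[ℂ] (K →L[ℂ] K)) x
          (.ofMatrix (.diagonal fun _ => star (w k) * w k))).re)
    {χ : B →ₗ[ℂ] (K →L[ℂ] K)} (h1 : χ 1 = 1) (hχc : Continuous χ) (hχ : IsCstarCPmap χ)
    (hS : ∀ s ∈ S, χ s = π s) (b : B) : χ b = π b := by
  have hstate : ⇑(vecFunctional χ x) ∈ stateSet (CStarMatrix (Fin n) (Fin n) B) :=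
    coe_mem_stateSet (by rw [vecFunctional_one h1,
      ← vecFunctional_one (χ := (π : B →ₗ[ℂ] (K →L[ℂ] K))) (by simp) x, hx1])
      (hχ.vecFunctional_nonneg x)
  have h0 : (vecFunctional χ x (star M * M)).re
      = (vecFunctional (π : B →ₗ[ℂ] (K →L[ℂ] K)) x (star M * M)).re := by
    refine le_antisymm (hmax₀ _ hstate) ?_
    have e : vecFunctional χ x (star M * M)
        = ∑ k, ∑ i, ∑ j, ⟪x i, χ (star (M k i) * M k j) (x j)⟫_ℂ := by
      rw [vecFunctional_apply]
      simp only [CStarMatrix.mul_apply, CStarMatrix.star_apply, map_sum, _root_.sum_apply,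
        inner_sum]
      exact Finset.sum_comm_cycle
    rw [e, vecFunctional_star_mul_self, Complex.re_sum, Complex.re_sum]
    refine Finset.sum_le_sum fun k _ => ?_
    refine le_trans (le_of_eq ?_) (hχ.sq_norm_row_le h1 (M k) x)
    rw [← Complex.ofReal_pow, Complex.ofReal_re]
    simp only [hS _ (hM _ _)]
  have key (k : ℕ) : (∀ b j, χ (b * w k) (x j) = χ b (π (w k) (x j))) ∧
      (vecFunctional χ x (.ofMatrix (.diagonal fun _ => star (w k) * w k))).re =
        (vecFunctional (π : B →ₗ[ℂ] (K →L[ℂ] K)) x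
          (.ofMatrix (.diagonal fun _ => star (w k) * w k))).re := by
    induction k using Nat.strong_induction_on with
    | _ k ih =>
      rcases hw k with hk | ⟨m, hm, s, hs, hk⟩
      · refine ⟨fun b j => by simp [hk], ?_⟩
        rw [vecFunctional_diagonal, vecFunctional_diagonal]
        simp [hk, h1]
      · have hχw (j) : χ (w k) (x j) = π (w k) (x j) := by
          rw [hk, (ih m hm).1, hS s hs, map_mul]; rfl
        have hle (j) : ‖π (w k) (x j)‖ ^ 2 ≤ (⟪x j, χ (star (w k) * w k) (x j)⟫_ℂ).re := by
          simpa [hχw] using hχ.sq_norm_row_le h1 (fun _ : Fin 1 => w k) fun _ => x j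
        have hπ (j) : (⟪x j, π (star (w k) * w k) (x j)⟫_ℂ).re = ‖π (w k) (x j)‖ ^ 2 := by
          rw [map_mul, map_star]
          exact re_inner_star_mul_self _ _
        have hmaxk := hmax k _ hstate h0 fun m hm => (ih m hm).2
        rw [vecFunctional_diagonal, vecFunctional_diagonal, Complex.re_sum, Complex.re_sum]
          at hmaxk ⊢
        simp only [LinearMap.coe_coe, hπ]
          at hmaxk ⊢
        have heq := (Finset.sum_eq_sum_iff_of_le fun j _ => hle j).1
          (le_antisymm (Finset.sum_le_sum fun j _ => hle j) hmaxk)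
        refine ⟨fun b j => ?_, Finset.sum_congr rfl fun j hj => (heq j hj).symm⟩
        rw [hχ.apply_mul_of_inner_eq h1 _ b, hχw]
        rw [hχw, heq j (Finset.mem_univ j)]
  have hmul (b c : B) (j) : χ (b * c) (x j) = χ b (π c (x j)) := by
    have hπc := π.continuous_toCLM
    have hcl : IsClosed {c : B | χ (b * c) (x j) = χ b (π c (x j))} :=
      isClosed_eq (by fun_prop) (by fun_prop)
    refine hcl.closure_subset_iff.2 ?_ (hwd c)
    intro c hc
    induction hc using Submodule.span_induction with
    | mem c hc =>
      obtain ⟨k, rfl⟩ := hc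
      exact (key k).1 b j
    | zero => simp
    | add c d _ _ hc hd => simp_all [mul_add]
    | smul z c _ hc => simp_all
  have hχπ (c : B) (j) : χ c (x j) = π c (x j) := by simpa [h1] using hmul 1 c j
  refine ContinuousLinearMap.ext_on hcyc ?_
  rintro _ ⟨c, j, rfl⟩
  rw [← hmul, hχπ, map_mul]
  rfl

end Extension

section Commutant

variable {n : ℕ} {B K : Type*} [NormedAddCommGroup K] [InnerProductSpace ℂ K] [CompleteSpace K]
  [CStarAlgebra B]

/-- The functional obtained by inserting an operator from the commutant. -/
lemma vecFunctional_mulLeft_star_mul_self {π : B →⋆ₐ[ℂ] (K →L[ℂ] K)} {R : K →L[ℂ] K}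
    (hR : ∀ b, R * π b = π b * R) (x : Fin n → K) (D : CStarMatrix (Fin n) (Fin n) B) :
    vecFunctional (LinearMap.mulLeft ℂ R ∘ₗ (π : B →ₗ[ℂ] (K →L[ℂ] K))) x (star D * D)
      = ∑ k, ⟪∑ i, π (D k i) (x i), R (∑ j, π (D k j) (x j))⟫_ℂ := by
  have h (a b : B) (u v : K) : ⟪u, R (π (star a * b) v)⟫_ℂ = ⟪π a u, R (π b v)⟫_ℂ := by
    have h1 : R (π (star a * b) v) = star (π a) (R (π b v)) := by
      rw [map_mul, ← map_star]
      exact DFunLike.congr_fun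
        (show R * (π (star a) * π b) = π (star a) * (R * π b) by rw [← mul_assoc, hR, mul_assoc]) v
    rw [h1, ContinuousLinearMap.star_eq_adjoint, ContinuousLinearMap.adjoint_inner_right]
  rw [vecFunctional_apply]
  simp only [map_sum, sum_inner, inner_sum, CStarMatrix.mul_apply, CStarMatrix.star_apply,
    LinearMap.comp_apply, LinearMap.mulLeft_apply, LinearMap.coe_coe,
    _root_.sum_apply]
  simp only [← h]
  rw [Finset.sum_comm_cycle]
  refine Finset.sum_congr rfl fun k _ => Finset.sum_comm.trans ?_
  rfl

lemma eq_zero_of_vecFunctional_mulLeft_eq_zero {π : B →⋆ₐ[ℂ] (K →L[ℂ] K)} {x : Fin n → K}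
    (hcyc : Dense (Submodule.span ℂ {y | ∃ b i, y = π b (x i)} : Set K)) {R : K →L[ℂ] K}
    (hR : ∀ b, R * π b = π b * R)
    (h0 : ∀ D, vecFunctional (LinearMap.mulLeft ℂ R ∘ₗ (π : B →ₗ[ℂ] (K →L[ℂ] K))) x D = 0) :
    R = 0 := by
  have h (i j b) : ⟪x i, R (π b (x j))⟫_ℂ = 0 := by
    rw [← h0 (.ofMatrix (.single i j b)), vecFunctional_apply, Finset.sum_eq_single i,
      Finset.sum_eq_single j]
    · simp
    · intro k _ hk
      simp [hk.symm]
    · simp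
    · intro k _ hk
      simp [hk.symm]
    · simp
  refine ContinuousLinearMap.ext_on hcyc ?_
  rintro _ ⟨b, j, rfl⟩
  refine hcyc.eq_zero_of_inner_right (𝕜 := ℂ) fun y hy => ?_
  induction hy using Submodule.span_induction with
  | mem y hy =>
    obtain ⟨a, i, rfl⟩ := hy
    have h1 : star (π a) (R (π b (x j))) = R (π (star a * b) (x j)) := by
      rw [map_mul, ← map_star]
      exact DFunLike.congr_fun (show π (star a) * (R * π b) = R * (π (star a) * π b) by
        rw [← mul_assoc R, hR (star a), mul_assoc]) (x j)
    rw [← ContinuousLinearMap.adjoint_inner_right, ← ContinuousLinearMap.star_eq_adjoint, h1, h]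
  | zero => simp
  | add y z _ _ hy hz => rw [inner_add_left, hy, hz, add_zero]
  | smul c y _ hy => rw [inner_smul_left, hy, mul_zero]

lemma exists_eq_smul_one_of_isSelfAdjoint [PartialOrder B] [StarOrderedRing B]
    {π : B →⋆ₐ[ℂ] (K →L[ℂ] K)} {x : Fin n → K}
    (hcyc : Dense (Submodule.span ℂ {y | ∃ b i, y = π b (x i)} : Set K))
    (hext : ⇑(vecFunctional (π : B →ₗ[ℂ] (K →L[ℂ] K)) x) ∈
      (stateSet (CStarMatrix (Fin n) (Fin n) B)).extremePoints ℝ)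
    {T : K →L[ℂ] K} (hT : IsSelfAdjoint T) (hcomm : ∀ b, T * π b = π b * T) :
    ∃ c : ℂ, T = c • (1 : K →L[ℂ] K) := by
  set g := fun R : K →L[ℂ] K =>
    vecFunctional (LinearMap.mulLeft ℂ R ∘ₗ (π : B →ₗ[ℂ] (K →L[ℂ] K))) x with hg
  have hgadd (R R' D) : g (R + R') D = g R D + g R' D := by
    simp [hg, vecFunctional_apply, Finset.sum_add_distrib]
  have hgsmul (c : ℂ) (R D) : g (c • R) D = c * g R D := by
    simp [hg, vecFunctional_apply, Finset.mul_sum]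
  have hg1 (D) : g 1 D = vecFunctional (π : B →ₗ[ℂ] (K →L[ℂ] K)) x D := by
    simp [hg, vecFunctional_apply]
  have hpos {R : K →L[ℂ] K} (hR : ∀ b, R * π b = π b * R) (hR0 : ∀ v, 0 ≤ ⟪v, R v⟫_ℂ) (D) :
      0 ≤ g R (star D * D) := by
    simp only [hg, vecFunctional_mulLeft_star_mul_self hR]
    exact Finset.sum_nonneg fun _ _ => hR0 _
  have hone : g 1 1 = 1 := (hg1 1).trans hext.1.2.2.1
  have hreal {R : K →L[ℂ] K} (hR : IsSelfAdjoint R) (v : K) : ((⟪v, R v⟫_ℂ).re : ℂ) = ⟪v, R v⟫_ℂ :=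
    hR.isSymmetric.coe_re_inner_self_apply v
  set τ : ℝ := ∑ i, (⟪x i, T (x i)⟫_ℂ).re with hτ
  have hτT : g T 1 = τ := by
    have := vecFunctional_diagonal (LinearMap.mulLeft ℂ T ∘ₗ (π : B →ₗ[ℂ] (K →L[ℂ] K))) x 1
    have h1 : (CStarMatrix.ofMatrix (Matrix.diagonal fun _ => (1 : B)) :
      CStarMatrix (Fin n) (Fin n) B) = 1 := rfl
    rw [h1] at this
    simp only [hg, this, hτ, Complex.ofReal_sum, hreal hT]
    simp
  set T₀ := T - (τ : ℂ) • (1 : K →L[ℂ] K) with hT₀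
  have hT₀comm (b) : T₀ * π b = π b * T₀ := by simp [hT₀, sub_mul, mul_sub, hcomm]
  have hT₀sa : IsSelfAdjoint T₀ := hT.sub (.smul (by simp [isSelfAdjoint_iff]) (.one _))
  have hT₀1 : g T₀ 1 = 0 := by
    have := hgadd T₀ ((τ : ℂ) • 1) 1
    rw [hgsmul, hone, sub_add_cancel, hτT] at this
    simpa using this.symm
  have hε : 0 < ‖T₀‖ + 1 := by positivity
  have hbd (δ : ℝ) (hδ : |δ| * (‖T₀‖ + 1) ≤ 1) :
      ⇑(g (1 + (δ : ℂ) • T₀)) ∈ stateSet (CStarMatrix (Fin n) (Fin n) B) := by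
    refine coe_mem_stateSet (by rw [hgadd, hgsmul, hone, hT₀1]; simp) fun D => hpos ?_ ?_ D
    · intro b
      simp [add_mul, mul_add, hT₀comm]
    · intro v
      have h1 : |(⟪v, T₀ v⟫_ℂ).re| ≤ ‖T₀‖ * ‖v‖ ^ 2 := by
        refine (Complex.abs_re_le_norm _).trans ((norm_inner_le_norm _ _).trans ?_)
        nlinarith [T₀.le_opNorm v, norm_nonneg v]
      have h2 : ⟪v, (1 + (δ : ℂ) • T₀) v⟫_ℂ = ((‖v‖ ^ 2 + δ * (⟪v, T₀ v⟫_ℂ).re : ℝ) : ℂ) := by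
        have := inner_self_eq_norm_sq_to_K (𝕜 := ℂ) v
        push_cast
        rw [hreal hT₀sa]
        simp
      rw [h2, Complex.zero_le_real]
      have h3 : |δ * (⟪v, T₀ v⟫_ℂ).re| ≤ ‖v‖ ^ 2 := by
        rw [abs_mul]
        calc _ ≤ |δ| * ((‖T₀‖ + 1) * ‖v‖ ^ 2) := by gcongr; nlinarith [sq_nonneg ‖v‖]
          _ = |δ| * (‖T₀‖ + 1) * ‖v‖ ^ 2 := by ring
          _ ≤ 1 * ‖v‖ ^ 2 := by gcongr
          _ = _ := one_mul _
      linarith [neg_abs_le (δ * (⟪v, T₀ v⟫_ℂ).re)]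
  set ε := (‖T₀‖ + 1)⁻¹ with hεdef
  have hε0 : 0 < ε := by positivity
  have hεle : |ε| * (‖T₀‖ + 1) ≤ 1 := by
    rw [abs_of_pos hε0, hεdef, inv_mul_cancel₀ hε.ne']
  have heq := hext.2 (hbd ε hεle) (hbd (-ε) (by rwa [abs_neg]))
    ⟨1 / 2, 1 / 2, by norm_num, by norm_num, by norm_num, by
      ext D
      simp only [Pi.add_apply, Pi.smul_apply, hgadd, hgsmul, hg1, Complex.real_smul]
      push_cast
      ring⟩
  refine ⟨τ, sub_eq_zero.1 (eq_zero_of_vecFunctional_mulLeft_eq_zero hcyc hT₀comm fun D => ?_)⟩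
  have := congrFun heq D
  rw [hgadd, hgsmul, hg1, add_eq_left] at this
  exact (mul_eq_zero.1 this).resolve_left (by exact_mod_cast ne_of_gt hε0)

/-- The representation associated with an extreme state is irreducible. -/
theorem hasTrivialCommutant_of_mem_extremePoints [PartialOrder B] [StarOrderedRing B]
    {π : B →⋆ₐ[ℂ] (K →L[ℂ] K)} {x : Fin n → K}
    (hcyc : Dense (Submodule.span ℂ {y | ∃ b i, y = π b (x i)} : Set K))
    (hext : ⇑(vecFunctional (π : B →ₗ[ℂ] (K →L[ℂ] K)) x) ∈
      (stateSet (CStarMatrix (Fin n) (Fin n) B)).extremePoints ℝ) :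
    HasTrivialCommutant ⇑π := by
  intro T hT
  have hT' (b) : star T * π b = π b * star T := by
    simpa [← map_star] using congrArg star (hT (star b)).symm
  obtain ⟨c, hc⟩ := exists_eq_smul_one_of_isSelfAdjoint hcyc hext (T := T + star T)
    (by simp [isSelfAdjoint_iff, add_comm]) fun b => by simp [add_mul, mul_add, hT, hT']
  obtain ⟨d, hd⟩ := exists_eq_smul_one_of_isSelfAdjoint hcyc hext (T := Complex.I • (T - star T))
    (by simp [isSelfAdjoint_iff, ← smul_neg]) fun b => by simp [sub_mul, mul_sub, hT, hT']
  refine ⟨(1 / 2) * (c - Complex.I * d), ?_⟩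
  rw [mul_smul, sub_smul, mul_smul, ← hc, ← hd, smul_smul, Complex.I_mul_I]
  module

end Commutant

/-- Words in a countable dense subset of a generating set span a dense subspace. -/
theorem exists_words {B : Type*} [CStarAlgebra B] [TopologicalSpace.SeparableSpace B]
    {S : Set B} (hne : S.Nonempty) (hstar : ∀ s ∈ S, star s ∈ S)
    (hgen : Dense ((StarAlgebra.adjoin ℂ S : StarSubalgebra ℂ B) : Set B)) :
    ∃ w : ℕ → B, (∀ k, w k = 1 ∨ ∃ m < k, ∃ s ∈ S, w k = s * w m) ∧
      Dense (Submodule.span ℂ (Set.range w) : Set B) := by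
  have : Nonempty S := hne.to_subtype
  obtain ⟨d, hd⟩ := TopologicalSpace.exists_dense_seq S
  let w : ℕ → B := fun k => ((Denumerable.ofNat (List ℕ) k).map fun i => (d i : B)).prod
  have hw0 : w 0 = 1 := by simp [w]
  have hws (v : ℕ) : w (v + 1) = d v.unpair.1 * w v.unpair.2 := by simp [w]
  have hwc (i k : ℕ) : ∃ v, w v = d i * w k := ⟨Nat.pair i k + 1, by simp [hws]⟩
  refine ⟨w, fun k => ?_, ?_⟩
  · rcases k with _ | v
    · exact .inl hw0
    · exact .inr ⟨_, Nat.lt_succ_of_le (Nat.unpair_right_le v), _, (d _).2, hws v⟩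
  set V := (Submodule.span ℂ (Set.range w)).topologicalClosure with hV
  have hVcl : IsClosed (V : Set B) := Submodule.isClosed_topologicalClosure _
  have hle : Submodule.span ℂ (Set.range w) ≤ V := Submodule.le_topologicalClosure _
  have hclosure {c : B} (h : ∀ k, c * w k ∈ V) : ∀ v ∈ V, c * v ∈ V := by
    have hcl : IsClosed {v : B | c * v ∈ V} := hVcl.preimage (by fun_prop)
    refine fun v hv => hcl.closure_subset_iff.2 (fun v hv => ?_) hv
    induction hv using Submodule.span_induction with
    | mem v hv =>
      obtain ⟨k, rfl⟩ := hv
      exact h k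
    | zero => simp
    | add u v _ _ hu hv => simpa [mul_add] using V.add_mem hu hv
    | smul z v _ hv => simpa using V.smul_mem z hv
  have hS {s : B} (hs : s ∈ S) : ∀ v ∈ V, s * v ∈ V := by
    refine hclosure fun k => ?_
    have hcl : IsClosed {s : S | (s : B) * w k ∈ V} := hVcl.preimage (by fun_prop)
    refine hcl.closure_subset_iff.2 ?_ (hd ⟨s, hs⟩)
    rintro _ ⟨i, rfl⟩
    obtain ⟨v, hv⟩ := hwc i k
    exact (congrArg (· ∈ V) hv).mp (hle (Submodule.subset_span ⟨v, rfl⟩))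
  have key {c : B} (hc : c ∈ StarAlgebra.adjoin ℂ S) :
      (∀ v ∈ V, c * v ∈ V) ∧ ∀ v ∈ V, star c * v ∈ V := by
    induction hc using StarAlgebra.adjoin_induction with
    | mem s hs => exact ⟨hS hs, hS (hstar s hs)⟩
    | algebraMap z =>
      exact ⟨fun v hv => by simpa [Algebra.algebraMap_eq_smul_one] using V.smul_mem z hv,
        fun v hv => by simpa [Algebra.algebraMap_eq_smul_one] using V.smul_mem (star z) hv⟩
    | add a b _ _ ha hb =>
      exact ⟨fun v hv => by simpa [add_mul] using V.add_mem (ha.1 v hv) (hb.1 v hv),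
        fun v hv => by simpa [add_mul] using V.add_mem (ha.2 v hv) (hb.2 v hv)⟩
    | mul a b _ _ ha hb => exact ⟨fun v hv => by simpa [mul_assoc] using ha.1 _ (hb.1 v hv),
        fun v hv => by simpa [mul_assoc] using hb.2 _ (ha.2 v hv)⟩
    | star a _ ha => exact ⟨ha.2, by simpa using ha.1⟩
  have h1 : (1 : B) ∈ V := hle (Submodule.subset_span ⟨0, hw0⟩)
  intro b
  refine hVcl.closure_subset_iff.2 (fun c hc => ?_) (hgen b)
  simpa using (key hc).1 1 h1

/-- Every norm of a matrix over a generating operator system is attained at an irreducible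
representation with the unique extension property. -/
theorem exists_boundaryRep_norming {n : ℕ} {B : Type*} [CStarAlgebra B] [PartialOrder B]
    [StarOrderedRing B] [TopologicalSpace.SeparableSpace B]
    {S : Set B} (hstar : ∀ s ∈ S, star s ∈ S)
    (hgen : Dense ((StarAlgebra.adjoin ℂ S : StarSubalgebra ℂ B) : Set B))
    {M : CStarMatrix (Fin n) (Fin n) B} (hM : ∀ i j, M i j ∈ S) (hM0 : M ≠ 0) :
    ∃ (K : Type) (_ : NormedAddCommGroup K) (_ : InnerProductSpace ℂ K) (_ : CompleteSpace K)
      (π : B →⋆ₐ[ℂ] (K →L[ℂ] K)) (x : Fin n → K),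
      HasTrivialCommutant ⇑π ∧
      (∀ χ : B →ₗ[ℂ] (K →L[ℂ] K), χ 1 = 1 → Continuous χ → IsCstarCPmap χ →
        (∀ s ∈ S, χ s = π s) → ∀ b, χ b = π b) ∧
      (∀ D : CStarMatrix (Fin n) (Fin n) B, ∑ k, ‖∑ j, π (D k j) (x j)‖ ^ 2 ≤ ‖D‖ ^ 2) ∧
      ∑ k, ‖∑ j, π (M k j) (x j)‖ ^ 2 = ‖M‖ ^ 2 := by
  let C := CStarMatrix (Fin n) (Fin n) B
  let _ : PartialOrder C := CStarAlgebra.spectralOrder C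
  let _ : StarOrderedRing C := CStarAlgebra.spectralOrderedRing C
  have hne : S.Nonempty := by
    by_contra h
    refine hM0 ?_
    ext i
    exact (h ⟨_, hM i i⟩).elim
  obtain ⟨w, hw, hwd⟩ := exists_words hne hstar hgen
  have hMM : star M * M ≠ 0 := by rwa [Ne, CStarRing.star_mul_self_eq_zero_iff]
  obtain ⟨g, hg, hgM⟩ := exists_mem_stateSet_apply_eq_norm (star_mul_self_nonneg M) hMM
  let c : ℕ → C := fun k => k.casesOn (star M * M) fun k =>
    .ofMatrix (.diagonal fun _ => star (w k) * w k)
  let L (k : ℕ) : StrongDual ℝ (C → ℂ) := Complex.reCLM ∘L ContinuousLinearMap.proj (c k)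
  obtain ⟨f, hf, hmax⟩ := exists_extremePoint_lexicographic_max isCompact_stateSet ⟨g, hg⟩ L
  have hL (k : ℕ) (f : C → ℂ) : L k f = (f (c k)).re := rfl
  simp only [hL] at hmax
  obtain ⟨f, rfl⟩ := exists_linearMap_of_mem_stateSet hf.1
  obtain ⟨K, _, _, _, π, x, rfl, hd⟩ := exists_eq_vecFunctional hf.1.2.2.2
  have hsq (D : C) : (vecFunctional (π : B →ₗ[ℂ] (K →L[ℂ] K)) x (star D * D)).re
      = ∑ k, ‖∑ j, π (D k j) (x j)‖ ^ 2 := by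
    rw [vecFunctional_star_mul_self, Complex.re_sum]
    exact Finset.sum_congr rfl fun k _ => by rw [← Complex.ofReal_pow, Complex.ofReal_re]
  have hle (D : C) : (vecFunctional (π : B →ₗ[ℂ] (K →L[ℂ] K)) x (star D * D)).re ≤ ‖D‖ ^ 2 := by
    refine (Complex.re_le_norm _).trans
      ((LinearMap.norm_apply_le_of_nonneg hf.1.2.2.2 _).trans_eq ?_)
    rw [hf.1.2.2.1, CStarRing.norm_star_mul_self, sq]
    simp
  refine ⟨K, _, _, _, π, x, hasTrivialCommutant_of_mem_extremePoints hd hf,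
    fun χ h1 hχc hχ hS b => eq_of_lexicographic_max hd hf.1.2.2.1 hM hw hwd
      (fun f hf => hmax 0 f hf (by simp)) (fun k f hf h0 hk => hmax (k + 1) f hf fun m hm => ?_)
      h1 hχc hχ hS b,
    fun D => hsq D ▸ hle D, (hsq M).symm.trans (le_antisymm (hle M) ?_)⟩
  · rcases m with _ | m
    · exact h0
    · exact hk m (Nat.lt_of_succ_lt_succ hm)
  · have := hmax 0 g hg (by simp)
    change (g (star M * M)).re ≤ _ at this
    rwa [hgM, Complex.ofReal_re, CStarRing.norm_star_mul_self, ← sq] at this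

lemma IsSelfAdjoint.exists_negPart {D : Type*} [CStarAlgebra D] {a : D} (ha : IsSelfAdjoint a) :
    ∃ b s t : D, star b = b ∧ b = star s * s ∧ a * b = -(b * b) ∧ a + b = star t * t := by
  let _ : PartialOrder D := CStarAlgebra.spectralOrder D
  let _ : StarOrderedRing D := CStarAlgebra.spectralOrderedRing D
  obtain ⟨s, hs⟩ := CStarAlgebra.nonneg_iff_eq_star_mul_self.1 (CFC.negPart_nonneg a)
  obtain ⟨t, ht⟩ := CStarAlgebra.nonneg_iff_eq_star_mul_self.1 (CFC.posPart_nonneg a)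
  refine ⟨a⁻, s, t, IsSelfAdjoint.of_nonneg (CFC.negPart_nonneg a), hs, ?_, ?_⟩
  · nth_rw 1 [← CFC.posPart_sub_negPart a ha, sub_mul, CFC.posPart_mul_negPart, zero_sub]
  · rw [← ht]
    nth_rw 1 [← CFC.posPart_sub_negPart a ha, sub_add_cancel]

section Quadratic

variable {n : ℕ} {K : Type*} [NormedAddCommGroup K] [InnerProductSpace ℂ K] [CompleteSpace K]

lemma sum_inner_star_mul_mul (T X : Matrix (Fin n) (Fin n) (K →L[ℂ] K)) (x : Fin n → K) :
    ∑ i, ∑ j, ⟪x i, (star X * T * X) i j (x j)⟫_ℂ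
      = ∑ k, ∑ l, ⟪∑ i, X k i (x i), T k l (∑ j, X l j (x j))⟫_ℂ := by
  have h (u v : K) (P Q R : K →L[ℂ] K) : ⟪u, (star P * Q * R) v⟫_ℂ = ⟪P u, Q (R v)⟫_ℂ := by
    have : (star P * Q * R) v = star P (Q (R v)) := rfl
    rw [this, ContinuousLinearMap.star_eq_adjoint, ContinuousLinearMap.adjoint_inner_right]
  simp only [Matrix.mul_apply, Matrix.star_apply, Finset.sum_mul, _root_.sum_apply, inner_sum,
    sum_inner, map_sum, h]
  have e1 (f : Fin n → Fin n → Fin n → Fin n → ℂ) :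
      ∑ i, ∑ j, ∑ l, ∑ k, f i j l k = ∑ k, ∑ l, ∑ i, ∑ j, f i j l k := by
    calc _ = ∑ i, ∑ k, ∑ j, ∑ l, f i j l k := Finset.sum_congr rfl fun i _ => Finset.sum_comm_cycle
      _ = ∑ k, ∑ i, ∑ j, ∑ l, f i j l k := Finset.sum_comm
      _ = _ := Finset.sum_congr rfl fun k _ => Finset.sum_comm_cycle
  rw [e1]
  refine Finset.sum_congr rfl fun k _ => Finset.sum_congr rfl fun l _ => ?_
  exact Finset.sum_comm

/-- A self-adjoint operator matrix with nonnegative quadratic form is positive. -/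
theorem matPosOp_of_sum_inner_nonneg {T : Matrix (Fin n) (Fin n) (K →L[ℂ] K)} (hT : star T = T)
    (hpos : ∀ x : Fin n → K, 0 ≤ ∑ i, ∑ j, ⟪x i, T i j (x j)⟫_ℂ) : MatPosOp T := by
  obtain ⟨b, s, t, hbsa, hs, hab, ht⟩ :=
    IsSelfAdjoint.exists_negPart (D := CStarMatrix (Fin n) (Fin n) (K →L[ℂ] K))
      (a := .ofMatrix T) hT
  set a : CStarMatrix (Fin n) (Fin n) (K →L[ℂ] K) := .ofMatrix T
  have hbab : star b * a * b = -(star (s * b) * (s * b)) := by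
    rw [star_mul, mul_assoc (star b) (star s), ← mul_assoc (star s), ← hs, mul_assoc, hab, mul_neg]
  have hsb : s * b = 0 := by
    have h1 (x : Fin n → K) : ∑ k, (‖∑ j, (s * b) k j (x j)‖ ^ 2 : ℂ) ≤ 0 := by
      have h2 := (hpos fun k => ∑ j, b k j (x j)).trans_eq
        (sum_inner_star_mul_mul T (CStarMatrix.ofMatrix.symm b) x).symm
      change 0 ≤ ∑ i, ∑ j, ⟪x i, (star b * a * b) i j (x j)⟫_ℂ at h2
      rw [hbab] at h2
      have h3 := sum_inner_star_mul_self (CStarMatrix.ofMatrix.symm (s * b)) x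
      change ∑ i, ∑ j, ⟪x i, (star (s * b) * (s * b)) i j (x j)⟫_ℂ = _ at h3
      have h4 : ∑ i, ∑ j, ⟪x i, (-(star (s * b) * (s * b))) i j (x j)⟫_ℂ
          = - ∑ i, ∑ j, ⟪x i, (star (s * b) * (s * b)) i j (x j)⟫_ℂ := by
        simp only [CStarMatrix.neg_apply, _root_.neg_apply, inner_neg_right,
          Finset.sum_neg_distrib]
      rw [h4, h3] at h2
      simpa using h2
    ext k j v
    have h2 := h1 (Pi.single j v)
    norm_cast at h2
    have h3 := (Finset.sum_eq_zero_iff_of_nonneg fun _ _ => sq_nonneg _).1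
      (le_antisymm h2 (Finset.sum_nonneg fun _ _ => sq_nonneg _)) k (Finset.mem_univ k)
    rw [sq_eq_zero_iff, norm_eq_zero, Finset.sum_eq_single j] at h3
    · simpa using h3
    · intro l _ hl
      simp [Pi.single_eq_of_ne hl]
    · simp
  have hbb : star b * b = 0 := by
    have h1 : b * b = star s * (s * b) := by rw [← mul_assoc, ← hs]
    rw [hbsa, h1, hsb, mul_zero]
  have hb00 : b = 0 := (CStarRing.star_mul_self_eq_zero_iff _).1 hbb
  rw [hb00, add_zero] at ht
  exact ⟨CStarMatrix.ofMatrix.symm t, ht⟩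

end Quadratic

section Compression

variable {n : ℕ} {B X : Type*} [CStarAlgebra B]

/-- Twice the self-adjoint part of the compression of a kernel to finitely many points. -/
def hermCompress (v : Fin n → X) (M : X × X →₀ B) : CStarMatrix (Fin n) (Fin n) B :=
  CStarMatrix.ofMatrix (.of fun i j => M (v i, v j) + star (M (v j, v i)))

lemma hermCompress_apply (v : Fin n → X) (M : X × X →₀ B) (i j : Fin n) :
    hermCompress v M i j = M (v i, v j) + star (M (v j, v i)) := rfl

lemma hermCompress_add (v : Fin n → X) (M N : X × X →₀ B) :
    hermCompress v (M + N) = hermCompress v M + hermCompress v N := by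
  ext i j
  simp only [hermCompress_apply, CStarMatrix.add_apply, Finsupp.add_apply, star_add]
  abel

lemma hermCompress_smul (v : Fin n → X) (c : ℝ) (M : X × X →₀ B) :
    hermCompress v (c • M) = c • hermCompress v M := by
  ext i j
  simp [hermCompress_apply]

lemma isSelfAdjoint_hermCompress (v : Fin n → X) (M : X × X →₀ B) :
    IsSelfAdjoint (hermCompress v M) := by
  ext i j
  simp [hermCompress_apply, CStarMatrix.star_apply, add_comm]

variable [PartialOrder B] [StarOrderedRing B]

lemma CStarMatrix.row_nonneg (y : Fin n → B) :
    0 ≤ (CStarMatrix.ofMatrix (.of fun i j => star (y i) * y j) :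
      CStarMatrix (Fin n) (Fin n) B) := by
  rcases isEmpty_or_nonempty (Fin n) with h | ⟨⟨i₀⟩⟩
  · exact le_of_eq (by ext i; exact isEmptyElim i)
  convert star_mul_self_nonneg
    (CStarMatrix.ofMatrix (.of fun k j => if k = i₀ then y j else 0) :
      CStarMatrix (Fin n) (Fin n) B)
  ext i j
  simp [CStarMatrix.mul_apply, CStarMatrix.star_apply, apply_ite star]

/-- The cone of kernels whose compressions are positive modulo a subspace. -/
def compressCone (X : Type*) (I : Submodule ℂ B) : PointedCone ℝ (X × X →₀ B) where
  carrier := {M | ∀ (n : ℕ) (v : Fin n → X), ∃ C : CStarMatrix (Fin n) (Fin n) B,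
    (∀ i j, C i j ∈ I) ∧ 0 ≤ hermCompress v M + C}
  add_mem' {M N} hM hN n v := by
    obtain ⟨C, hC, hC0⟩ := hM n v
    obtain ⟨D, hD, hD0⟩ := hN n v
    refine ⟨C + D, fun i j => I.add_mem (hC i j) (hD i j), ?_⟩
    rw [hermCompress_add, add_add_add_comm]
    exact add_nonneg hC0 hD0
  zero_mem' n v := ⟨0, fun i j => I.zero_mem, by
    rw [add_zero]
    refine le_of_eq ?_
    ext i j
    simp [hermCompress_apply]⟩
  smul_mem' c M hM n v := by
    obtain ⟨C, hC, hC0⟩ := hM n v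
    refine ⟨(c : ℝ) • C, fun i j => I.smul_mem ((c : ℝ) : ℂ) (hC i j), ?_⟩
    have : hermCompress v (c • M) = (c : ℝ) • hermCompress v M := hermCompress_smul v c M
    rw [this, ← smul_add]
    exact smul_nonneg c.2 hC0

lemma mem_compressCone_of_herm_mem {I : Submodule ℂ B} {M : X × X →₀ B}
    (h : ∀ u v, M (u, v) + star (M (v, u)) ∈ I) : M ∈ compressCone X I := fun n v =>
  ⟨-hermCompress v M, fun i j => I.neg_mem (h _ _), by rw [add_neg_cancel]⟩

lemma mem_compressCone_of_nonneg {I : Submodule ℂ B} {M : X × X →₀ B}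
    (h : ∀ (n : ℕ) (v : Fin n → X), 0 ≤ hermCompress v M) : M ∈ compressCone X I := fun n v =>
  ⟨0, fun i j => I.zero_mem, by rw [add_zero]; exact h n v⟩

open Classical in
lemma dominating_entry {R : Type*} [Ring R] [StarRing R] {b e t α : R}
    (he : star e * e = α * α - star b * b) (ht : star t = t) (hα : star α = α)
    (htt : t + t = 1 + α * α) (P Q P' Q' : Prop) :
    star ((if P then 1 else 0) + b * if P' then 1 else 0) *
            ((if Q then 1 else 0) + b * if Q' then 1 else 0) +
          star (α * if P then 1 else 0) * (α * if Q then 1 else 0) +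
        star (if P' then (1 : R) else 0) * (if Q' then 1 else 0) +
      star (e * if P' then 1 else 0) * (e * if Q' then 1 else 0) =
    (if P ∧ Q then t else 0) + (if P' ∧ Q' then t else 0) + (if P ∧ Q' then b else 0) +
      star ((if Q ∧ P then t else 0) + (if Q' ∧ P' then t else 0) + (if Q ∧ P' then b else 0)) := by
  have hαα : α * α = t + t - 1 := by rw [htt, add_sub_cancel_left]
  by_cases hP : P <;> by_cases hQ : Q <;> by_cases hP' : P' <;> by_cases hQ' : Q' <;>
    simp only [hP, hQ, hP', hQ', if_true, if_false, and_true, and_false,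
      star_one, star_zero, mul_one, mul_zero, zero_mul, one_mul, add_zero, zero_add, star_add, he,
      ht, hα, hαα, add_mul, mul_add]
  all_goals try abel

/-- The kernels with entries in the unital subspace `S` dominate all kernels. -/
lemma exists_add_mem_compressCone {S I : Submodule ℂ B} (h1 : (1 : B) ∈ S) (M : X × X →₀ B) :
    ∃ N : X × X →₀ B, (∀ q, N q ∈ S) ∧ N + M ∈ compressCone X I := by
  classical
  induction M using Finsupp.induction_linear with
  | zero => exact ⟨0, fun q => S.zero_mem, by simp⟩
  | add M M' hM hM' =>
    obtain ⟨N, hN, hNM⟩ := hM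
    obtain ⟨N', hN', hNM'⟩ := hM'
    exact ⟨N + N', fun q => S.add_mem (hN q) (hN' q), add_add_add_comm N N' M M' ▸
      add_mem hNM hNM'⟩
  | single q b =>
    obtain ⟨v, w⟩ := q
    have hb : star b * b ≤ algebraMap ℝ B (‖b‖ ^ 2) := by
      have := IsSelfAdjoint.le_algebraMap_norm_self (.star_mul_self b)
      rwa [CStarRing.norm_star_mul_self, ← sq] at this
    obtain ⟨e, he⟩ := CStarAlgebra.nonneg_iff_eq_star_mul_self.1 (sub_nonneg.2 hb)
    set c : ℝ := (1 + ‖b‖ ^ 2) / 2 with hc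
    have hS (r : ℝ) : (algebraMap ℝ B r) ∈ S := by
      rw [Algebra.algebraMap_eq_smul_one]
      exact S.smul_mem (r : ℂ) h1
    refine ⟨Finsupp.single (v, v) (algebraMap ℝ B c) + Finsupp.single (w, w) (algebraMap ℝ B c),
      fun q => S.add_mem ?_ ?_, mem_compressCone_of_nonneg fun n u => ?_⟩
    · rw [Finsupp.single_apply]
      split_ifs
      exacts [hS c, S.zero_mem]
    · rw [Finsupp.single_apply]
      split_ifs
      exacts [hS c, S.zero_mem]
    let a (i : Fin n) : B := if v = u i then 1 else 0
    let d (i : Fin n) : B := if w = u i then 1 else 0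
    have hsum := add_nonneg (add_nonneg (add_nonneg
      (CStarMatrix.row_nonneg fun i => a i + b * d i)
      (CStarMatrix.row_nonneg fun i => algebraMap ℝ B ‖b‖ * a i))
      (CStarMatrix.row_nonneg d)) (CStarMatrix.row_nonneg fun i => e * d i)
    refine hsum.trans_eq ?_
    ext i j
    have h2 : algebraMap ℝ B c + algebraMap ℝ B c = 1 + algebraMap ℝ B (‖b‖ ^ 2) := by
      rw [← map_add, hc, add_halves, map_add, map_one]
    have h3 : star e * e = algebraMap ℝ B ‖b‖ * algebraMap ℝ B ‖b‖ - star b * b := by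
      rw [← he, sq, map_mul]
    have h4 : star (algebraMap ℝ B c) = algebraMap ℝ B c := IsSelfAdjoint.algebraMap B (.all c)
    have h5 : star (algebraMap ℝ B ‖b‖) = algebraMap ℝ B ‖b‖ := IsSelfAdjoint.algebraMap B (.all _)
    simp only [hermCompress_apply, CStarMatrix.add_apply, Finsupp.add_apply, Finsupp.single_apply,
      Prod.mk.injEq, CStarMatrix.ofMatrix_apply, Matrix.of_apply, a, d]
    refine dominating_entry h3 h4 h5 ?_ _ _ _ _
    rw [h2, sq, map_mul]

end Compression

section ExtensionKernel

variable {B H : Type*} [CStarAlgebra B] [NormedAddCommGroup H] [InnerProductSpace ℂ H]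

/-- The sum `∑ ⟪v, π(M(v, w)) w⟫` over the entries of a kernel. -/
noncomputable def kernelPairing (π : B →ₗ[ℂ] (H →L[ℂ] H)) : (H × H →₀ B) →ₗ[ℂ] ℂ :=
  Finsupp.lsum ℂ fun q =>
    (innerSL ℂ q.1).toLinearMap ∘ₗ (ContinuousLinearMap.apply ℂ H q.2).toLinearMap ∘ₗ π

lemma kernelPairing_apply (π : B →ₗ[ℂ] (H →L[ℂ] H)) (M : H × H →₀ B) :
    kernelPairing π M = M.sum fun q b => ⟪q.1, π b q.2⟫_ℂ := rfl

lemma kernelPairing_single (π : B →ₗ[ℂ] (H →L[ℂ] H)) (v w : H) (b : B) :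
    kernelPairing π (Finsupp.single (v, w) b) = ⟪v, π b w⟫_ℂ := by
  simp [kernelPairing_apply]

lemma exists_kernelPairing_eq_sum (π : B →ₗ[ℂ] (H →L[ℂ] H)) (M : H × H →₀ B) :
    ∃ (n : ℕ) (v : Fin n → H), kernelPairing π M = ∑ i, ∑ j, ⟪v i, π (M (v i, v j)) (v j)⟫_ℂ := by
  classical
  let F : Finset H := M.support.image Prod.fst ∪ M.support.image Prod.snd
  have hF : M.support ⊆ F ×ˢ F := fun q hq => Finset.mem_product.2
    ⟨Finset.mem_union_left _ (Finset.mem_image_of_mem _ hq),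
      Finset.mem_union_right _ (Finset.mem_image_of_mem _ hq)⟩
  have hsum (f : H → ℂ) : ∑ u ∈ F, f u = ∑ i, f (F.equivFin.symm i) := by
    rw [← Finset.sum_coe_sort]
    exact (Equiv.sum_comp F.equivFin.symm fun u : F => f u).symm
  refine ⟨F.card, fun i => F.equivFin.symm i, ?_⟩
  rw [kernelPairing_apply, Finsupp.sum_of_support_subset M hF _ (by simp), Finset.sum_product,
    hsum]
  exact Finset.sum_congr rfl fun i _ => hsum _

variable [CompleteSpace H]

lemma two_re_eq_vecFunctional_hermCompress {n : ℕ} (π : B →⋆ₐ[ℂ] (H →L[ℂ] H)) (M : H × H →₀ B)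
    (v : Fin n → H) :
    vecFunctional (π : B →ₗ[ℂ] (H →L[ℂ] H)) v (hermCompress v M)
      = ∑ i, ∑ j, ⟪v i, π (M (v i, v j)) (v j)⟫_ℂ
        + star (∑ i, ∑ j, ⟪v i, π (M (v i, v j)) (v j)⟫_ℂ) := by
  simp only [star_sum]
  rw [Finset.sum_comm (f := fun i j => star ⟪v i, π (M (v i, v j)) (v j)⟫_ℂ),
    ← Finset.sum_add_distrib, vecFunctional_apply]
  refine Finset.sum_congr rfl fun i _ => ?_
  rw [← Finset.sum_add_distrib]
  refine Finset.sum_congr rfl fun j _ => ?_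
  have h : ⟪v i, π (star (M (v j, v i))) (v j)⟫_ℂ = star ⟪v j, π (M (v j, v i)) (v i)⟫_ℂ := by
    rw [map_star, ContinuousLinearMap.star_eq_adjoint, ContinuousLinearMap.adjoint_inner_right]
    exact (inner_conj_symm _ _).symm
  rw [← h, hermCompress_apply]
  change ⟪v i, π (_ + _) (v j)⟫_ℂ = _
  rw [map_add, _root_.add_apply, inner_add_right]

variable [PartialOrder B] [StarOrderedRing B]

lemma exists_eq_star_mul_self_of_nonneg {D : Type*} [CStarAlgebra D] [PartialOrder D]
    [StarOrderedRing D] {m : D} (hm : 0 ≤ m) : ∃ z : D, m = star z * z :=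
  CStarAlgebra.nonneg_iff_eq_star_mul_self.1 hm

lemma nonneg_of_isometric_add_nonneg {D : Type*} [CStarAlgebra D] [PartialOrder D]
    [StarOrderedRing D] {m c : D} (hm : IsSelfAdjoint m)
    (h : ∀ t : ℝ, ‖algebraMap ℝ D t - m‖ ≤ ‖algebraMap ℝ D t - m - c‖) (hmc : 0 ≤ m + c) :
    0 ≤ m := by
  refine nonneg_of_norm_algebraMap_sub_le hm (t := ‖m + c‖) ((h _).trans ?_)
  rw [sub_sub]
  exact norm_algebraMap_norm_sub_le hmc

lemma re_kernelPairing_nonneg {S I : Submodule ℂ B} (h1 : (1 : B) ∈ S)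
    (hS : ∀ s ∈ S, star s ∈ S)
    (iso : ∀ (n : ℕ) (M C : CStarMatrix (Fin n) (Fin n) B), (∀ i j, M i j ∈ S) →
      (∀ i j, C i j ∈ I) → ‖M‖ ≤ ‖M + C‖)
    (π : B →⋆ₐ[ℂ] (H →L[ℂ] H)) {M : H × H →₀ B} (hM : ∀ q, M q ∈ S)
    (hMI : M ∈ compressCone H I) : 0 ≤ (kernelPairing (π : B →ₗ[ℂ] (H →L[ℂ] H)) M).re := by
  obtain ⟨n, v, hv⟩ := exists_kernelPairing_eq_sum (π : B →ₗ[ℂ] (H →L[ℂ] H)) M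
  obtain ⟨C, hC, hC0⟩ := hMI n v
  have hm (i j) : hermCompress v M i j ∈ S := S.add_mem (hM _) (hS _ (hM _))
  have hm0 : 0 ≤ hermCompress v M := by
    refine nonneg_of_isometric_add_nonneg (isSelfAdjoint_hermCompress v M) (fun t => ?_) hC0
    rw [sub_eq_add_neg _ C]
    refine iso n _ _ (fun i j => ?_) fun i j => I.neg_mem (hC i j)
    refine S.sub_mem ?_ (hm i j)
    rw [Algebra.algebraMap_eq_smul_one]
    refine S.smul_mem (t : ℂ) ?_
    rw [CStarMatrix.one_apply]
    split_ifs
    exacts [h1, S.zero_mem]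
  obtain ⟨z, hz⟩ := exists_eq_star_mul_self_of_nonneg hm0
  have h := two_re_eq_vecFunctional_hermCompress π M v
  have hv' : kernelPairing (π : B →ₗ[ℂ] (H →L[ℂ] H)) M
    = ∑ i, ∑ j, ⟪v i, π (M (v i, v j)) (v j)⟫_ℂ := hv
  rw [hz, vecFunctional_star_mul_self, ← hv'] at h
  have h' := congrArg Complex.re h
  norm_cast at h'
  simp only [Complex.add_re, RCLike.star_def, Complex.conj_re] at h'
  have : 0 ≤ ∑ k, ‖∑ j, π (z k j) (v j)‖ ^ 2 := Finset.sum_nonneg fun _ _ => sq_nonneg _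
  linarith

end ExtensionKernel

section ExtensionKernel

variable {B H : Type*} [CStarAlgebra B] {I : Submodule ℂ B} {G : (H × H →₀ B) →ₗ[ℝ] ℝ}

/-- The complex functionals obtained from a real functional on kernels. -/
noncomputable def kernelFunctional (G : (H × H →₀ B) →ₗ[ℝ] ℝ) (v w : H) : B →ₗ[ℂ] ℂ :=
  Module.Dual.extendRCLike (G ∘ₗ Finsupp.lsingle (v, w))

lemma re_kernelFunctional (v w : H) (b : B) :
    (kernelFunctional G v w b).re = G (Finsupp.single (v, w) b) :=
  Module.Dual.re_extendRCLike_apply (𝕜 := ℂ) (G ∘ₗ Finsupp.lsingle (v, w)) b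

lemma im_kernelFunctional (v w : H) (b : B) :
    (kernelFunctional G v w b).im = -G (Finsupp.single (v, w) (Complex.I • b)) :=
  Module.Dual.im_extendRCLike_apply (𝕜 := ℂ) (G ∘ₗ Finsupp.lsingle (v, w)) b

lemma kernelFunctional_eq_inner [NormedAddCommGroup H] [InnerProductSpace ℂ H]
    {S : Submodule ℂ B} {π : B →ₗ[ℂ] (H →L[ℂ] H)}
    (hGS : ∀ M, (∀ q, M q ∈ S) → G M = (kernelPairing π M).re)
    (v w : H) {s : B} (hs : s ∈ S) :
    kernelFunctional G v w s = ⟪v, π s w⟫_ℂ := by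
  classical
  have hsingle (t : B) (ht : t ∈ S) (q) : Finsupp.single (v, w) t q ∈ S := by
    rw [Finsupp.single_apply]
    split_ifs
    exacts [ht, S.zero_mem]
  apply Complex.ext
  · rw [re_kernelFunctional, hGS _ (hsingle s hs), kernelPairing_single]
  · rw [im_kernelFunctional, hGS _ (hsingle _ (S.smul_mem _ hs)), kernelPairing_single, map_smul,
      _root_.smul_apply, inner_smul_right]
    simp

variable [PartialOrder B] [StarOrderedRing B]

lemma eq_zero_of_herm_mem (hG : ∀ M ∈ compressCone H I, 0 ≤ G M) {M : H × H →₀ B}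
    (h : ∀ u v, M (u, v) + star (M (v, u)) ∈ I) : G M = 0 := by
  refine le_antisymm ?_ (hG M (mem_compressCone_of_herm_mem h))
  have := hG (-M) (mem_compressCone_of_herm_mem fun u v => by
    have := I.neg_mem (h u v)
    rwa [neg_add, ← star_neg] at this)
  rwa [map_neg, neg_nonneg] at this

lemma map_single_star (hG : ∀ M ∈ compressCone H I, 0 ≤ G M) (v w : H) (b : B) :
    G (Finsupp.single (v, w) (star b)) = G (Finsupp.single (w, v) b) := by
  classical
  rw [← sub_eq_zero, ← map_sub]
  refine eq_zero_of_herm_mem hG fun u u' => ?_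
  convert I.zero_mem
  simp only [Finsupp.sub_apply, Finsupp.single_apply, Prod.mk.injEq, star_sub, apply_ite star,
    star_star, star_zero, and_comm (a := v = u), and_comm (a := w = u)]
  abel

lemma kernelFunctional_star (hG : ∀ M ∈ compressCone H I, 0 ≤ G M) (v w : H) (b : B) :
    kernelFunctional G v w (star b) = star (kernelFunctional G w v b) := by
  apply Complex.ext
  · rw [RCLike.star_def, Complex.conj_re, re_kernelFunctional, re_kernelFunctional,
      map_single_star hG]
  · rw [RCLike.star_def, Complex.conj_im, im_kernelFunctional, im_kernelFunctional]
    have : Complex.I • star b = star (-(Complex.I • b)) := by simp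
    rw [this, map_single_star hG, Finsupp.single_neg, map_neg]

lemma kernelForm_kernelFunctional_nonneg (hG : ∀ M ∈ compressCone H I, 0 ≤ G M) (r : H →₀ B) :
    0 ≤ kernelForm (kernelFunctional G) r r := by
  classical
  have him : (kernelForm (kernelFunctional G) r r).im = 0 :=
    Complex.conj_eq_iff_im.1 (star_kernelForm (kernelFunctional_star hG) r r)
  refine Complex.nonneg_iff.2 ⟨?_, him.symm⟩
  let N : H × H →₀ B :=
    ∑ i ∈ r.support, ∑ j ∈ r.support, Finsupp.single (i, j) (star (r i) * r j)
  have hN : (kernelForm (kernelFunctional G) r r).re = G N := by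
    simp only [kernelForm, Finsupp.sum, Complex.re_sum, re_kernelFunctional, N, map_sum]
  have hN' (u v : H) : N (u, v) = star (r u) * r v := by
    simp only [N, Finsupp.finsetSum_apply, Finsupp.single_apply, Prod.mk.injEq, ite_and]
    rw [Finset.sum_eq_single u, Finset.sum_eq_single v]
    · simp
    · intro j _ hj
      simp [hj]
    · intro h
      simp [Finsupp.notMem_support_iff.1 h]
    · intro i _ hi
      simp [hi]
    · intro h
      simp [Finsupp.notMem_support_iff.1 h]
  rw [hN]
  refine hG N (mem_compressCone_of_nonneg fun n v => ?_)
  convert add_nonneg (CStarMatrix.row_nonneg fun i => r (v i))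
    (CStarMatrix.row_nonneg fun i => r (v i))
  ext i j
  rw [hermCompress_apply, hN', hN', star_mul, star_star]
  rfl

lemma kernelFunctional_eq_zero (hI : ∀ c ∈ I, star c ∈ I)
    (hG : ∀ M ∈ compressCone H I, 0 ≤ G M) (v w : H) {c : B} (hc : c ∈ I) :
    kernelFunctional G v w c = 0 := by
  classical
  have h (c : B) (hc : c ∈ I) : G (Finsupp.single (v, w) c) = 0 := by
    refine eq_zero_of_herm_mem hG fun u u' => I.add_mem ?_ (hI _ ?_) <;>
    · rw [Finsupp.single_apply]
      split_ifs
      exacts [hc, I.zero_mem]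
  apply Complex.ext
  · rw [re_kernelFunctional, h c hc, Complex.zero_re]
  · rw [im_kernelFunctional, h _ (I.smul_mem _ hc), neg_zero, Complex.zero_im]

lemma exists_functional_extension [NormedAddCommGroup H] [InnerProductSpace ℂ H] [CompleteSpace H]
    {S I : Submodule ℂ B} (h1 : (1 : B) ∈ S)
    (hS : ∀ s ∈ S, star s ∈ S)
    (iso : ∀ (n : ℕ) (M C : CStarMatrix (Fin n) (Fin n) B), (∀ i j, M i j ∈ S) →
      (∀ i j, C i j ∈ I) → ‖M‖ ≤ ‖M + C‖)
    (π : B →⋆ₐ[ℂ] (H →L[ℂ] H)) :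
    ∃ G : (H × H →₀ B) →ₗ[ℝ] ℝ,
      (∀ M, (∀ q, M q ∈ S) → G M = (kernelPairing (π : B →ₗ[ℂ] (H →L[ℂ] H)) M).re) ∧
      ∀ M ∈ compressCone H I, 0 ≤ G M := by
  let dom : Submodule ℝ (H × H →₀ B) :=
    { carrier := {M | ∀ q, M q ∈ S}
      add_mem' := fun hM hN q => S.add_mem (hM q) (hN q)
      zero_mem' := fun q => S.zero_mem
      smul_mem' := fun c M hM q => S.smul_mem (c : ℂ) (hM q) }
  let f : (H × H →₀ B) →ₗ.[ℝ] ℝ :=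
    { domain := dom
      toFun := (Complex.reLm ∘ₗ (kernelPairing (π : B →ₗ[ℂ] (H →L[ℂ] H))).restrictScalars ℝ) ∘ₗ
        dom.subtype }
  obtain ⟨G, hGf, hG⟩ := riesz_extension (compressCone H I) f
    (fun M hM => re_kernelPairing_nonneg h1 hS iso π M.2 hM)
    (fun M => by
      obtain ⟨N, hN, hNM⟩ := exists_add_mem_compressCone (I := I) h1 M
      exact ⟨⟨N, hN⟩, hNM⟩)
  exact ⟨G, fun M hM => hGf ⟨M, hM⟩, hG⟩

end ExtensionKernel

section Dilation

variable {H K : Type*} [NormedAddCommGroup H] [InnerProductSpace ℂ H]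
  [NormedAddCommGroup K] [InnerProductSpace ℂ K]

lemma exists_linearIsometry_of_inner {x : H → K} (hx : ∀ v w, ⟪x v, x w⟫_ℂ = ⟪v, w⟫_ℂ) :
    ∃ V : H →ₗᵢ[ℂ] K, ∀ v, V v = x v := by
  have hnorm (v) : ‖x v‖ = ‖v‖ := by
    rw [norm_eq_sqrt_re_inner (𝕜 := ℂ), hx, ← norm_eq_sqrt_re_inner]
  refine ⟨⟨⟨⟨x, fun v w => ?_⟩, fun c v => ?_⟩, hnorm⟩, fun v => rfl⟩
  · rw [← sub_eq_zero, ← inner_self_eq_zero (𝕜 := ℂ)]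
    simp only [inner_sub_left, inner_sub_right, inner_add_left, inner_add_right, hx]
    ring
  · rw [← sub_eq_zero, ← inner_self_eq_zero (𝕜 := ℂ)]
    simp only [inner_sub_left, inner_sub_right, inner_smul_left, inner_smul_right, hx,
      RingHom.id_apply]
    ring

variable [CompleteSpace H] [CompleteSpace K] {B : Type*} [CStarAlgebra B]

/-- The compression `b ↦ V* ρ(b) V` of a representation by an isometry. -/
noncomputable def isometryCompression (V : H →ₗᵢ[ℂ] K) (ρ : B →⋆ₐ[ℂ] (K →L[ℂ] K)) :
    B →ₗ[ℂ] (H →L[ℂ] H) where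
  toFun b := ContinuousLinearMap.adjoint V.toContinuousLinearMap ∘L ρ b ∘L V.toContinuousLinearMap
  map_add' a b := by ext; simp
  map_smul' c b := by ext; simp

lemma inner_isometryCompression (V : H →ₗᵢ[ℂ] K) (ρ : B →⋆ₐ[ℂ] (K →L[ℂ] K)) (b : B) (v w : H) :
    ⟪v, isometryCompression V ρ b w⟫_ℂ = ⟪V v, ρ b (V w)⟫_ℂ :=
  ContinuousLinearMap.adjoint_inner_right V.toContinuousLinearMap v (ρ b (V w))

lemma norm_isometryCompression_le (V : H →ₗᵢ[ℂ] K) (ρ : B →⋆ₐ[ℂ] (K →L[ℂ] K)) (b : B) :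
    ‖isometryCompression V ρ b‖ ≤ ‖b‖ := by
  refine ContinuousLinearMap.opNorm_le_of_re_inner_le (norm_nonneg b) fun v w hv hw => ?_
  rw [inner_re_symm, inner_isometryCompression]
  calc _ ≤ ‖V w‖ * ‖ρ b (V v)‖ := re_inner_le_norm _ _
    _ ≤ ‖V w‖ * (‖ρ b‖ * ‖V v‖) := by gcongr; exact (ρ b).le_opNorm _
    _ = ‖ρ b‖ := by rw [V.norm_map, V.norm_map, hv, hw, one_mul, mul_one]
    _ ≤ ‖b‖ := NonUnitalStarAlgHom.norm_apply_le ρ b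

lemma isometryCompression_star (V : H →ₗᵢ[ℂ] K) (ρ : B →⋆ₐ[ℂ] (K →L[ℂ] K)) (b : B) :
    isometryCompression V ρ (star b) = star (isometryCompression V ρ b) := by
  ext w
  refine ext_inner_left ℂ fun v => ?_
  rw [ContinuousLinearMap.star_eq_adjoint, ContinuousLinearMap.adjoint_inner_right,
    inner_isometryCompression, map_star, ContinuousLinearMap.star_eq_adjoint,
    ContinuousLinearMap.adjoint_inner_right, ← inner_conj_symm, ← inner_isometryCompression,
    inner_conj_symm]

lemma isCstarCPmap_isometryCompression (V : H →ₗᵢ[ℂ] K) (ρ : B →⋆ₐ[ℂ] (K →L[ℂ] K)) :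
    IsCstarCPmap (isometryCompression V ρ) := by
  rintro n _ ⟨X, rfl⟩
  refine matPosOp_of_sum_inner_nonneg ?_ fun x => ?_
  · ext1 i j
    have h : star ((star X * X) j i) = (star X * X) i j := by
      rw [← Matrix.star_apply, star_mul, star_star]
    rw [Matrix.star_apply, Matrix.map_apply, Matrix.map_apply, ← isometryCompression_star, h]
  · have h := vecFunctional_star_mul_self ρ (fun i => V (x i)) (.ofMatrix X)
    have h' : ∑ i, ∑ j, ⟪x i, (star X * X).map (isometryCompression V ρ) i j (x j)⟫_ℂ
        = vecFunctional (ρ : B →ₗ[ℂ] (K →L[ℂ] K)) (fun i => V (x i))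
          (star (.ofMatrix X) * .ofMatrix X) := by
      rw [vecFunctional_apply]
      exact Finset.sum_congr rfl fun i _ => Finset.sum_congr rfl fun j _ =>
        inner_isometryCompression V ρ _ _ _
    rw [h', h]
    exact Finset.sum_nonneg fun k _ => by norm_cast; positivity

end Dilation

/-- Arveson extension of a representation from an operator system, vanishing on a subspace modulo
which the operator system embeds completely isometrically. -/
theorem exists_isCstarCPmap_extension {B H : Type*} [CStarAlgebra B] [PartialOrder B]
    [StarOrderedRing B] [NormedAddCommGroup H] [InnerProductSpace ℂ H] [CompleteSpace H]
    {S I : Submodule ℂ B} (h1 : (1 : B) ∈ S) (hS : ∀ s ∈ S, star s ∈ S)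
    (hI : ∀ c ∈ I, star c ∈ I)
    (iso : ∀ (n : ℕ) (M C : CStarMatrix (Fin n) (Fin n) B), (∀ i j, M i j ∈ S) →
      (∀ i j, C i j ∈ I) → ‖M‖ ≤ ‖M + C‖)
    (π : B →⋆ₐ[ℂ] (H →L[ℂ] H)) :
    ∃ φ : B →ₗ[ℂ] (H →L[ℂ] H), φ 1 = 1 ∧ (∀ b, ‖φ b‖ ≤ ‖b‖) ∧ IsCstarCPmap φ ∧
      (∀ s ∈ S, φ s = π s) ∧ ∀ c ∈ I, φ c = 0 := by
  obtain ⟨G, hGS, hG⟩ := exists_functional_extension h1 hS iso π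
  obtain ⟨K, _, _, _, ρ, x, hx, -⟩ := exists_rep_of_kernel (kernelFunctional G)
    (kernelFunctional_star hG) (kernelForm_kernelFunctional_nonneg hG)
  obtain ⟨V, hV⟩ := exists_linearIsometry_of_inner (x := x) fun v w => by
    have := hx v w 1
    rw [kernelFunctional_eq_inner hGS v w h1, map_one] at this
    exact this.trans (by rw [show (π : B →ₗ[ℂ] (H →L[ℂ] H)) 1 = 1 from map_one π]; rfl)
  have hinner (b v w) : ⟪v, isometryCompression V ρ b w⟫_ℂ = kernelFunctional G v w b := by
    rw [inner_isometryCompression, hV, hV, hx]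
  have hSeq : ∀ s ∈ S, isometryCompression V ρ s = π s := fun s hs => by
    ext w
    refine ext_inner_left ℂ fun v => ?_
    rw [hinner, kernelFunctional_eq_inner hGS v w hs]
    rfl
  refine ⟨isometryCompression V ρ, ?_, norm_isometryCompression_le V ρ,
    isCstarCPmap_isometryCompression V ρ, hSeq, fun c hc => ?_⟩
  · rw [hSeq 1 h1, map_one]
  · ext w
    refine ext_inner_left ℂ fun v => ?_
    rw [hinner, kernelFunctional_eq_zero hI hG v w hc]
    simp

namespace IsCstarSeminorm

section Basic

variable {R : Type*} [Ring R] [StarRing R] [Algebra ℂ R] {q : R → ℝ}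

lemma one_le_one (hq : IsCstarSeminorm q) : q 1 ≤ 1 := by
  have h := hq.cstar 1
  rw [star_one, one_mul] at h
  nlinarith [sq_nonneg (q 1 - 1)]

lemma pow_le (hq : IsCstarSeminorm q) (a : R) (k : ℕ) : q (a ^ k) ≤ q a ^ k := by
  induction k with
  | zero => simpa using hq.one_le_one
  | succ k ih =>
    rw [pow_succ, pow_succ]
    exact (hq.mul_le _ _).trans (mul_le_mul_of_nonneg_right ih (hq.nonneg a))

lemma neg_eq (hq : IsCstarSeminorm q) (a : R) : q (-a) = q a := by
  have := hq.smul (-1) a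
  simpa using this

lemma eq_of_sub_eq_zero (hq : IsCstarSeminorm q) {a b : R} (h : q (a - b) = 0) : q a = q b := by
  have h1 := hq.add_le (a - b) b
  have h2 := hq.add_le (-(a - b)) a
  rw [hq.neg_eq] at h2
  simp only [sub_add_cancel, neg_sub] at h1 h2
  linarith

end Basic

variable {D : Type*} [CStarAlgebra D] {q : D → ℝ}

lemma le_norm_of_isSelfAdjoint (hq : IsCstarSeminorm q) {a : D} (ha : IsSelfAdjoint a) :
    q a ≤ ‖a‖ := by
  let _ := CStarAlgebra.spectralOrder D
  let _ := CStarAlgebra.spectralOrderedRing D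
  have hunit (u : D) (hu : u ∈ unitary D) : q u ≤ 1 := by
    have h := hq.cstar u
    rw [Unitary.star_mul_self_of_mem hu] at h
    nlinarith [hq.one_le_one, hq.nonneg u]
  have hle (a : D) (ha : IsSelfAdjoint a) (h1 : ‖a‖ ≤ 1) : q a ≤ 1 := by
    set u := a + Complex.I • CFC.sqrt (1 - a ^ 2) with hu
    have hmem : u ∈ unitary D := ha.self_add_I_smul_cfcSqrt_sub_sq_mem_unitary a h1
    have hs : star (CFC.sqrt (1 - a ^ 2)) = CFC.sqrt (1 - a ^ 2) :=
      (CFC.sqrt_nonneg (1 - a ^ 2 : D)).isSelfAdjoint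
    have hau : a = (2⁻¹ : ℂ) • (u + star u) := by
      rw [hu, star_add, star_smul, hs, ha.star_eq, RCLike.star_def, Complex.conj_I, neg_smul,
        add_add_add_comm, add_neg_cancel, add_zero, ← two_smul ℂ a, smul_smul]
      norm_num
    rw [hau, hq.smul]
    have := hq.add_le u (star u)
    rw [hq.star_eq] at this
    have := hunit u hmem
    norm_num
    linarith
  rcases eq_or_ne a 0 with rfl | h0
  · rw [hq.map_zero', norm_zero]
  have hn : 0 < ‖a‖ := norm_pos_iff.2 h0
  have h := hle (((‖a‖⁻¹ : ℝ) : ℂ) • a) (by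
    rw [Complex.coe_smul]
    exact (IsSelfAdjoint.all (‖a‖⁻¹)).smul ha) (by
    rw [Complex.coe_smul, norm_smul, norm_inv, norm_norm, inv_mul_cancel₀ hn.ne'])
  rw [hq.smul, Complex.norm_real, norm_inv, norm_norm] at h
  rwa [inv_mul_le_iff₀ hn, mul_one] at h

lemma norm_le_of_star_mul_self (hq : IsCstarSeminorm q) (h0 : ∀ d, q d = 0 → d = 0) (d : D) :
    ‖star d * d‖ ≤ q (star d * d) := by
  cases subsingleton_or_nontrivial D
  · rw [Subsingleton.elim (star d * d) 0, norm_zero]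
    exact hq.nonneg 0
  let _ := CStarAlgebra.spectralOrder D
  let _ := CStarAlgebra.spectralOrderedRing D
  set a := star d * d
  have ha : IsSelfAdjoint a := .star_mul_self d
  have hnn : ∀ t ∈ spectrum ℝ a, 0 ≤ t := spectrum_nonneg_of_nonneg (star_mul_self_nonneg d)
  refine le_of_forall_gt_imp_ge_of_dense fun r hr => ?_
  have hr0 : 0 < r := (hq.nonneg a).trans_lt hr
  let f (t : ℝ) : ℝ := max (t - r) 0
  have hb (k : ℕ) : cfc f a = a ^ k * cfc (fun t => f t * ((max t r) ^ k)⁻¹) a := by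
    have hcont : ContinuousOn (fun t => f t * ((max t r) ^ k)⁻¹) (spectrum ℝ a) := by
      refine ContinuousOn.mul (by fun_prop) (ContinuousOn.inv₀ (by fun_prop) fun t _ => ?_)
      exact (pow_pos (hr0.trans_le (le_max_right t r)) k).ne'
    rw [← cfc_pow_id (R := ℝ) a k, ← cfc_mul _ _ a (by fun_prop) hcont]
    refine cfc_congr fun t _ => ?_
    dsimp only [f]
    rcases le_total t r with h | h
    · simp [h]
    · have : t ^ k ≠ 0 := (pow_pos (hr0.trans_le h) k).ne'
      rw [max_eq_left h]
      field_simp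
  have hc (k : ℕ) : ‖cfc (fun t => f t * ((max t r) ^ k)⁻¹) a‖ ≤ ‖a‖ * (r ^ k)⁻¹ := by
    refine norm_cfc_le (by positivity) fun t ht => ?_
    rw [norm_mul, norm_inv, norm_pow]
    have h1 : ‖f t‖ ≤ ‖a‖ := by
      have h2 := spectrum.norm_le_norm_of_mem ht
      have h3 := hnn t ht
      rw [Real.norm_of_nonneg (le_max_right _ _)]
      rw [Real.norm_of_nonneg h3] at h2
      exact max_le (by linarith) (norm_nonneg a)
    have h2 : r ≤ ‖max t r‖ := (le_max_right t r).trans (le_abs_self _)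
    gcongr
  have hqb (k : ℕ) : q (cfc f a) ≤ ‖a‖ * (q a / r) ^ k := by
    rw [hb k]
    have hsa : IsSelfAdjoint (cfc (fun t => f t * ((max t r) ^ k)⁻¹) a) := cfc_predicate _ a
    calc _ ≤ q a ^ k * (‖a‖ * (r ^ k)⁻¹) := (hq.mul_le _ _).trans <|
          mul_le_mul (hq.pow_le a k) ((hq.le_norm_of_isSelfAdjoint hsa).trans (hc k))
            (hq.nonneg _) (pow_nonneg (hq.nonneg a) k)
      _ = _ := by rw [div_pow]; ring
  have hlim : Filter.Tendsto (fun k : ℕ => ‖a‖ * (q a / r) ^ k) Filter.atTop (nhds 0) := by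
    simpa using (tendsto_pow_atTop_nhds_zero_of_lt_one (div_nonneg (hq.nonneg a) hr0.le)
      ((div_lt_one hr0).2 hr)).const_mul ‖a‖
  have hb0 : cfc f a = 0 := h0 _ (le_antisymm (ge_of_tendsto' hlim hqb) (hq.nonneg _))
  rw [← cfc_id' ℝ a]
  refine norm_cfc_le hr0.le fun t ht => ?_
  have h := norm_apply_le_norm_cfc f a ht
  rw [hb0, norm_zero, norm_le_zero_iff] at h
  rw [Real.norm_of_nonneg (hnn t ht)]
  have : t - r ≤ 0 := h ▸ le_max_left _ _
  linarith

/-- A C*-norm on a C*-algebra is the given norm. -/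
theorem eq_norm (hq : IsCstarSeminorm q) (h0 : ∀ d, q d = 0 → d = 0) (d : D) : q d = ‖d‖ := by
  have h : q (star d * d) = ‖star d * d‖ := le_antisymm
    (hq.le_norm_of_isSelfAdjoint (.star_mul_self d)) (hq.norm_le_of_star_mul_self h0 d)
  rw [hq.cstar, CStarRing.norm_star_mul_self, ← sq] at h
  exact (sq_eq_sq₀ (hq.nonneg d) (norm_nonneg d)).1 h

/-- A C*-seminorm on a *-algebra with the same kernel as a surjective *-homomorphism onto a
C*-algebra is the pullback of the norm. -/
theorem eq_norm_of_surjective {R : Type*} [Ring R] [StarRing R] [Algebra ℂ R] {q : R → ℝ}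
    (hq : IsCstarSeminorm q) {ψ : R → D} (hadd : ∀ a b, ψ (a + b) = ψ a + ψ b)
    (hsmul : ∀ (c : ℂ) a, ψ (c • a) = c • ψ a) (hmul : ∀ a b, ψ (a * b) = ψ a * ψ b)
    (hstar : ∀ a, ψ (star a) = star (ψ a)) (hsurj : Function.Surjective ψ)
    (hker : ∀ a, q a = 0 ↔ ψ a = 0) (a : R) : q a = ‖ψ a‖ := by
  have hneg (a) : ψ (-a) = -ψ a := by simpa using hsmul (-1) a
  have hwd (a b) (h : ψ a = ψ b) : q a = q b := hq.eq_of_sub_eq_zero <| (hker _).2 <| by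
    rw [sub_eq_add_neg, hadd, hneg, h, add_neg_cancel]
  let σ := Function.surjInv hsurj
  have hσ (d) : ψ (σ d) = d := Function.surjInv_eq hsurj d
  have hQ (a) : q (σ (ψ a)) = q a := hwd _ _ (hσ _)
  have hQ' : IsCstarSeminorm fun d => q (σ d) :=
    { nonneg := fun d => hq.nonneg _
      map_zero' := (hker _).2 (hσ 0)
      add_le := fun d e => by
        rw [hwd (σ (d + e)) (σ d + σ e) (by rw [hadd, hσ, hσ, hσ])]
        exact hq.add_le _ _
      smul := fun c d => by
        rw [hwd (σ (c • d)) (c • σ d) (by rw [hsmul, hσ, hσ])]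
        exact hq.smul _ _
      mul_le := fun d e => by
        rw [hwd (σ (d * e)) (σ d * σ e) (by rw [hmul, hσ, hσ, hσ])]
        exact hq.mul_le _ _
      star_eq := fun d => by
        rw [hwd (σ (star d)) (star (σ d)) (by rw [hstar, hσ, hσ])]
        exact hq.star_eq _
      cstar := fun d => by
        rw [hwd (σ (star d * d)) (star (σ d) * σ d) (by rw [hmul, hstar, hσ, hσ])]
        exact hq.cstar _ }
  rw [← hQ]
  exact hQ'.eq_norm (fun d hd => by rw [← hσ d]; exact (hker _).1 hd) (ψ a)

end IsCstarSeminorm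

lemma IsMatrixCstarSeminormFamily.eq_norm {A B : Type*} [Ring A] [StarRing A] [Algebra ℂ A]
    [CStarAlgebra B] [PartialOrder B] [StarOrderedRing B] {p : A → ℝ}
    {pn : ∀ n : ℕ, Matrix (Fin n) (Fin n) A → ℝ}
    (hpn : IsMatrixCstarSeminormFamily p pn) {π : A →⋆ₐ[ℂ] B} (hsurj : Function.Surjective π)
    (hnorm : ∀ a, ‖π a‖ = p a) {n : ℕ} (M : Matrix (Fin n) (Fin n) A) :
    pn n M = ‖CStarMatrix.ofMatrix (M.map π)‖ := by
  refine (hpn.cstar n).eq_norm_of_surjective (ψ := fun M => CStarMatrix.ofMatrix (M.map π))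
    (fun a b => ?_) (fun c a => ?_) (fun a b => ?_) (fun a => ?_) (fun d => ?_) (fun a => ?_) M
  · ext i j
    exact map_add π _ _
  · ext i j
    exact map_smul π _ _
  · ext i j
    exact congrFun₂ (Matrix.map_mul (f := π)) i j
  · ext i j
    exact map_star π _
  · refine ⟨.of fun i j => Function.surjInv hsurj (d i j), ?_⟩
    ext i j
    exact Function.surjInv_eq hsurj _
  · rw [hpn.ker]
    simp only [← hnorm, norm_eq_zero]
    exact ⟨fun h => by ext i j; exact h i j, fun h i j => congrFun₂ h i j⟩

section Descent

variable {A B : Type*} [Ring A] [StarRing A] [Algebra ℂ A] [CStarAlgebra B]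
  {q : A →⋆ₐ[ℂ] B}

lemma exists_linearMap_comp_eq {E : Type*} [AddCommGroup E] [Module ℂ E]
    (hq : Function.Surjective q) (f : A →ₗ[ℂ] E) (hf : ∀ a, q a = 0 → f a = 0) :
    ∃ g : B →ₗ[ℂ] E, ∀ a, g (q a) = f a := by
  have hwd (a b) (h : q a = q b) : f a = f b := by
    rw [← sub_eq_zero, ← map_sub]
    exact hf _ (by rw [map_sub, h, sub_self])
  have hσ (b) : q (Function.surjInv hq b) = b := Function.surjInv_eq hq b
  refine ⟨⟨⟨fun b => f (Function.surjInv hq b), fun b c => ?_⟩, fun c b => ?_⟩,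
    fun a => hwd _ _ (hσ _)⟩
  · rw [← map_add]
    exact hwd _ _ (by rw [map_add, hσ, hσ, hσ])
  · rw [RingHom.id_apply, ← map_smul]
    exact hwd _ _ (by rw [map_smul, hσ, hσ])

lemma exists_starAlgHom_comp_eq {D : Type*} [Ring D] [StarRing D] [Algebra ℂ D]
    (hq : Function.Surjective q) (f : A →⋆ₐ[ℂ] D) (hf : ∀ a, q a = 0 → f a = 0) :
    ∃ g : B →⋆ₐ[ℂ] D, ∀ a, g (q a) = f a := by
  obtain ⟨g, hg⟩ := exists_linearMap_comp_eq hq (f : A →ₗ[ℂ] D) hf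
  have hg' : ∀ a, g (q a) = f a := hg
  refine ⟨⟨AlgHom.ofLinearMap g ?_ fun b c => ?_, fun b => ?_⟩, hg'⟩
  · rw [← map_one q, hg', map_one]
  · obtain ⟨a, rfl⟩ := hq b
    obtain ⟨a', rfl⟩ := hq c
    rw [← map_mul, hg', hg', hg', map_mul]
  · obtain ⟨a, rfl⟩ := hq b
    change g (star (q a)) = star (g (q a))
    rw [← map_star, hg', hg', map_star]

variable {K : Type*} [NormedAddCommGroup K] [InnerProductSpace ℂ K] [CompleteSpace K]
  {p : A → ℝ} {pn : ∀ n : ℕ, Matrix (Fin n) (Fin n) A → ℝ}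

lemma isCstarCPmap_of_isLamCPmap (hpn : ∀ n, pn n 0 = 0) (hq : Function.Surjective q)
    {φ : A →ₗ[ℂ] (K →L[ℂ] K)} (hφ : IsLamCPmap pn φ) {g : B →ₗ[ℂ] (K →L[ℂ] K)}
    (hg : ∀ a, g (q a) = φ a) : IsCstarCPmap g := by
  rintro n _ ⟨X, rfl⟩
  let Y : Matrix (Fin n) (Fin n) A := .of fun i j => Function.surjInv hq (X i j)
  have hY : Y.map q = X := by
    ext i j
    exact Function.surjInv_eq hq _
  have h := hφ.1 n (star Y * Y) ⟨Y, 0, hpn n, by rw [add_zero]⟩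
  convert h using 1
  have h2 : star X * X = (star Y * Y).map q := by
    rw [Matrix.map_mul, hY]
    congr 1
    ext i j
    rw [← hY]
    exact (map_star q _).symm
  ext1 i j
  rw [h2]
  exact hg _

lemma isLamCPmap_comp_of_isCstarCPmap (hpn : ∀ n M, pn n M = 0 ↔ ∀ i j, q (M i j) = 0)
    {φ : B →ₗ[ℂ] (K →L[ℂ] K)} (hφ : IsCstarCPmap φ) :
    IsLamCPmap pn (φ ∘ₗ (q : A →ₗ[ℂ] B)) := by
  refine ⟨?_, fun n M hM => ?_⟩
  · rintro n _ ⟨x, c, hc, rfl⟩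
    have h := hφ n (star (x.map q) * x.map q) ⟨_, rfl⟩
    convert h using 1
    ext1 i j
    have h1 : q ((star x * x + c) i j) = (star (x.map q) * x.map q) i j := by
      rw [Matrix.add_apply, map_add, (hpn n c).1 hc i j, add_zero]
      have h2 : (star x).map q = star (x.map q) := by
        ext k l
        exact map_star q _
      rw [← h2]
      exact congrFun₂ (Matrix.map_mul (f := q)) i j
    exact congrArg φ h1
  · ext1 i j
    exact (congrArg φ ((hpn n M).1 hM i j)).trans (map_zero φ)

end Descent

section Level

variable {Λ A : Type*} [Ring A] [StarRing A] [Algebra ℂ A] {S : Submodule ℂ A}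
  {p : Λ → A → ℝ} {pn : Λ → ∀ n : ℕ, Matrix (Fin n) (Fin n) A → ℝ}
  {B : Type*} [CStarAlgebra B] {q : A →⋆ₐ[ℂ] B} {l : Λ}

/-- A boundary representation of a level quotient induces an admissible local boundary
representation. -/
lemma isAdmLocBdryRep_comp {K : Type*} [NormedAddCommGroup K] [InnerProductSpace ℂ K]
    [CompleteSpace K] (hpn : ∀ l, IsMatrixCstarSeminormFamily (p l) (pn l))
    (hq : Function.Surjective q) (hnorm : ∀ a, ‖q a‖ = p l a)
    {ρ : B →⋆ₐ[ℂ] (K →L[ℂ] K)} (hρ : HasTrivialCommutant ρ)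
    (huniq : ∀ χ : B →ₗ[ℂ] (K →L[ℂ] K), χ 1 = 1 → Continuous χ → IsCstarCPmap χ →
      (∀ s ∈ q '' S, χ s = ρ s) → ∀ b, χ b = ρ b) :
    IsAdmLocBdryRep p pn S (ρ.comp q) := by
  refine ⟨fun T hT => hρ T fun b => ?_, l, fun a => ?_, fun φ h1 hφ hφp hφS a => ?_⟩
  · obtain ⟨a, rfl⟩ := hq b
    exact hT a
  · rw [← hnorm]
    exact NonUnitalStarAlgHom.norm_apply_le ρ (q a)
  · obtain ⟨l', hφ⟩ := hφ
    obtain ⟨χ, hχ⟩ := exists_linearMap_comp_eq hq φ fun a ha => by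
      have := hφp a
      rwa [← hnorm, ha, norm_zero, norm_le_zero_iff] at this
    rw [← hχ]
    refine huniq χ (by rw [← map_one q, hχ, h1]) ?_
      (isCstarCPmap_of_isLamCPmap (fun n => ((hpn l').cstar n).map_zero') hq hφ hχ) ?_ _
    · refine AddMonoidHomClass.continuous_of_bound χ 1 fun b => ?_
      obtain ⟨a, rfl⟩ := hq b
      rw [hχ, one_mul, hnorm]
      exact hφp a
    · rintro _ ⟨s, hs, rfl⟩
      rw [hχ]
      exact hφS s hs

variable [PartialOrder B] [StarOrderedRing B]

/-- Adding entries annihilated by the admissible local boundary representations does not decrease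
the matrix seminorms on the local operator system. -/
lemma matrixSeminorm_le_add [TopologicalSpace.SeparableSpace B]
    (hpn : ∀ l, IsMatrixCstarSeminormFamily (p l) (pn l)) (hq : Function.Surjective q)
    (hnorm : ∀ a, ‖q a‖ = p l a) (hS : ∀ s ∈ S, star s ∈ S)
    (hgen : Dense ((StarAlgebra.adjoin ℂ (q '' S) : StarSubalgebra ℂ B) : Set B)) {n : ℕ}
    {M C : Matrix (Fin n) (Fin n) A} (hM : ∀ i j, M i j ∈ S)
    (hC : ∀ (H : Type) (_ : NormedAddCommGroup H) (_ : InnerProductSpace ℂ H)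
      (_ : CompleteSpace H) (πr : A →⋆ₐ[ℂ] (H →L[ℂ] H)),
      IsAdmLocBdryRep p pn S πr → ∀ i j, πr (C i j) = 0) :
    pn l n M ≤ pn l n (M + C) := by
  have hnn := ((hpn l).cstar n).nonneg (M + C)
  have hmk := (hpn l).eq_norm hq hnorm (n := n)
  by_cases h0 : CStarMatrix.ofMatrix (M.map q) = 0
  · rwa [hmk M, h0, norm_zero]
  obtain ⟨K, _, _, _, ρ, x, hρ, huniq, hle, heq⟩ := exists_boundaryRep_norming (S := q '' S)
    (by rintro _ ⟨s, hs, rfl⟩; exact ⟨star s, hS s hs, map_star q s⟩) hgen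
    (M := CStarMatrix.ofMatrix (M.map q)) (fun i j => ⟨M i j, hM i j, rfl⟩) h0
  have hkill := hC K _ _ _ (ρ.comp q) (isAdmLocBdryRep_comp hpn hq hnorm hρ huniq)
  have h := hle (CStarMatrix.ofMatrix ((M + C).map q))
  have hsum (k j) : ρ (CStarMatrix.ofMatrix ((M + C).map q) k j)
      = ρ (CStarMatrix.ofMatrix (M.map q) k j) := by
    change ρ (q (M k j + C k j)) = ρ (q (M k j))
    have := hkill k j
    rw [StarAlgHom.comp_apply] at this
    rw [map_add, map_add, this, add_zero]
  simp only [hsum] at h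
  rw [heq, ← hmk, ← hmk] at h
  exact (sq_le_sq₀ (((hpn l).cstar n).nonneg M) hnn).1 h

/-- An admissible local boundary representation annihilates every local boundary ideal. -/
lemma IsAdmLocBdryRep.apply_eq_zero {H : Type*} [NormedAddCommGroup H]
    [InnerProductSpace ℂ H] [CompleteSpace H] (hpn : IsMatrixCstarSeminormFamily (p l) (pn l))
    (hq : Function.Surjective q) (hnorm : ∀ a, ‖q a‖ = p l a) (h1 : (1 : A) ∈ S)
    (hS : ∀ s ∈ S, star s ∈ S) {I : TwoSidedIdeal A} (hI : ∀ a ∈ I, star a ∈ I)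
    (hiso : ∀ (n : ℕ) (M C : Matrix (Fin n) (Fin n) A), (∀ i j, M i j ∈ S) →
      (∀ i j, C i j ∈ I) → pn l n M ≤ pn l n (M + C))
    {πr : A →⋆ₐ[ℂ] (H →L[ℂ] H)} (hle : ∀ a, ‖πr a‖ ≤ p l a)
    (huniq : ∀ φ : A →ₗ[ℂ] (H →L[ℂ] H), φ 1 = 1 → (∃ l, IsLamCPmap (pn l) φ) →
      (∀ a, ‖φ a‖ ≤ p l a) → (∀ s ∈ S, φ s = πr s) → ∀ a, φ a = πr a) {a : A} (ha : a ∈ I) :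
    πr a = 0 := by
  obtain ⟨ρ, hρ⟩ := exists_starAlgHom_comp_eq hq πr fun a ha => by
    have := hle a
    rwa [← hnorm, ha, norm_zero, norm_le_zero_iff] at this
  let I' : Submodule ℂ B :=
    { carrier := q '' I
      add_mem' := by
        rintro _ _ ⟨a, ha, rfl⟩ ⟨b, hb, rfl⟩
        exact ⟨a + b, I.add_mem ha hb, map_add q a b⟩
      zero_mem' := ⟨0, I.zero_mem, map_zero q⟩
      smul_mem' := by
        rintro c _ ⟨a, ha, rfl⟩
        refine ⟨c • a, ?_, map_smul q c a⟩
        rw [Algebra.smul_def]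
        exact I.mul_mem_left _ _ ha }
  obtain ⟨φ, hφ1, hφle, hφcp, hφS, hφI⟩ := exists_isCstarCPmap_extension
    (S := S.map (q : A →ₗ[ℂ] B)) (I := I') ⟨1, h1, map_one q⟩
    (by rintro _ ⟨s, hs, rfl⟩; exact ⟨star s, hS s hs, map_star q s⟩)
    (by rintro _ ⟨s, hs, rfl⟩; exact ⟨star s, hI s hs, map_star q s⟩)
    (fun n M C hM hC => by
      choose m hm hmM using hM
      choose c hc hcC using hC
      have h := hiso n (.of m) (.of c) hm hc
      rw [hpn.eq_norm hq hnorm, hpn.eq_norm hq hnorm] at h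
      have hM' : CStarMatrix.ofMatrix ((Matrix.of m).map q) = M := by
        ext i j
        exact hmM i j
      have hMC : CStarMatrix.ofMatrix ((Matrix.of m + Matrix.of c).map q) = M + C := by
        ext i j
        exact (map_add q _ _).trans (congrArg₂ _ (hmM i j) (hcC i j))
      rwa [hM', hMC] at h) ρ
  have hker (n) (M : Matrix (Fin n) (Fin n) A) : pn l n M = 0 ↔ ∀ i j, q (M i j) = 0 := by
    simp only [hpn.ker, ← hnorm, norm_eq_zero]
  rw [← huniq (φ ∘ₗ (q : A →ₗ[ℂ] B)) ((congrArg φ (map_one q)).trans hφ1)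
    ⟨l, isLamCPmap_comp_of_isCstarCPmap hker hφcp⟩
    (fun a => (hφle _).trans (hnorm a).le)
    (fun s hs => (hφS _ ⟨s, hs, rfl⟩).trans (hρ s))]
  exact hφI _ ⟨a, ha, rfl⟩

end Level

section Ideal

variable {Λ A : Type*} [Ring A] [StarRing A] [Algebra ℂ A] {S : Submodule ℂ A}
  {p : Λ → A → ℝ} {pn : Λ → ∀ n : ℕ, Matrix (Fin n) (Fin n) A → ℝ}

/-- The intersection of the kernels of the admissible local boundary representations. -/
def bdryKernel (p : Λ → A → ℝ) (pn : Λ → ∀ n : ℕ, Matrix (Fin n) (Fin n) A → ℝ)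
    (S : Submodule ℂ A) : Set A :=
  {a : A | ∀ (H : Type) (_ : NormedAddCommGroup H) (_ : InnerProductSpace ℂ H)
    (_ : CompleteSpace H) (πr : A →⋆ₐ[ℂ] (H →L[ℂ] H)), IsAdmLocBdryRep p pn S πr → πr a = 0}

lemma exists_twoSidedIdeal_coe_eq_bdryKernel :
    ∃ J : TwoSidedIdeal A, (J : Set A) = bdryKernel p pn S :=
  ⟨TwoSidedIdeal.mk' (bdryKernel p pn S) (fun _ _ _ _ πr _ => map_zero πr)
    (fun ha hb H _ _ _ πr hπ => by rw [map_add, ha H _ _ _ πr hπ, hb H _ _ _ πr hπ, add_zero])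
    (fun ha H _ _ _ πr hπ => by rw [map_neg, ha H _ _ _ πr hπ, neg_zero])
    (fun hb H _ _ _ πr hπ => by rw [map_mul, hb H _ _ _ πr hπ, mul_zero])
    (fun ha H _ _ _ πr hπ => by rw [map_mul, ha H _ _ _ πr hπ, zero_mul]),
    TwoSidedIdeal.coe_mk' ..⟩

lemma star_mem_bdryKernel {a : A} (ha : a ∈ bdryKernel p pn S) : star a ∈ bdryKernel p pn S :=
  fun H _ _ _ πr hπ => by rw [map_star, ha H _ _ _ πr hπ, star_zero]

variable [TopologicalSpace A]

lemma IsLocBdryIdeal.seminorm_le {I : Set A} (hI : IsLocBdryIdeal pn S I)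
    (hpn : ∀ l, IsMatrixCstarSeminormFamily (p l) (pn l)) (l : Λ) {n : ℕ}
    {M C : Matrix (Fin n) (Fin n) A} (hM : ∀ i j, M i j ∈ S) (hC : ∀ i j, C i j ∈ I) :
    pn l n M ≤ pn l n (M + C) := by
  have h := hI.2.2.2 l n (.of fun i j => ⟨M i j, hM i j⟩)
  refine h.symm.trans_le (csInf_le ⟨0, ?_⟩ ⟨C, hC, rfl⟩)
  rintro _ ⟨C, -, rfl⟩
  exact ((hpn l).cstar n).nonneg _

variable {B : Λ → Type*} [∀ l, CStarAlgebra (B l)] {π : ∀ l, A →⋆ₐ[ℂ] B l}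

lemma isClosed_bdryKernel (hsurj : ∀ l, Function.Surjective (π l))
    (hnorm : ∀ l a, ‖π l a‖ = p l a) (hcont : ∀ l, Continuous (π l)) :
    IsClosed (bdryKernel p pn S) := by
  refine isClosed_of_closure_subset fun a ha H _ _ _ πr hπ => ?_
  obtain ⟨-, l, hle, -⟩ := id hπ
  obtain ⟨ρ, hρ⟩ := exists_starAlgHom_comp_eq (hsurj l) πr fun a ha => by
    have := hle a
    rwa [← hnorm, ha, norm_zero, norm_le_zero_iff] at this
  have hcl : IsClosed {a | πr a = 0} := by
    have : Continuous πr := by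
      have h : (πr : A → H →L[ℂ] H) = ρ ∘ π l := funext fun a => (hρ a).symm
      rw [h]
      exact (StarAlgHom.continuous_toCLM ρ).comp (hcont l)
    exact isClosed_eq this continuous_const
  have hsub : bdryKernel p pn S ⊆ {a | πr a = 0} := fun b hb => hb H _ _ _ πr hπ
  exact closure_minimal hsub hcl ha

theorem isLocBdryIdeal_bdryKernel [StarModule ℂ A] [TopologicalSpace.SeparableSpace A]
    (hsurj : ∀ l, Function.Surjective (π l))
    (hnorm : ∀ l a, ‖π l a‖ = p l a) (hcont : ∀ l, Continuous (π l))
    (hpn : ∀ l, IsMatrixCstarSeminormFamily (p l) (pn l)) (hS : ∀ s ∈ S, star s ∈ S)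
    (hgen : Dense ((StarAlgebra.adjoin ℂ (S : Set A) : StarSubalgebra ℂ A) : Set A)) :
    IsLocBdryIdeal pn S (bdryKernel p pn S) := by
  refine ⟨exists_twoSidedIdeal_coe_eq_bdryKernel, fun _ => star_mem_bdryKernel,
    isClosed_bdryKernel hsurj hnorm hcont, fun l n M => IsLeast.csInf_eq ⟨⟨0, ?_, ?_⟩, ?_⟩⟩
  · exact fun i j H _ _ _ πr _ => map_zero πr
  · rw [add_zero]
  rintro _ ⟨C, hC, rfl⟩
  let _ := CStarAlgebra.spectralOrder (B l)
  let _ := CStarAlgebra.spectralOrderedRing (B l)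
  have : TopologicalSpace.SeparableSpace (B l) := (hsurj l).denseRange.separableSpace (hcont l)
  refine matrixSeminorm_le_add hpn (hsurj l) (hnorm l) hS ?_ (fun i j => (M i j).2)
    fun H _ _ _ πr hπ i j => hC i j H _ _ _ πr hπ
  rw [← StarAlgHom.map_adjoin]
  exact (hsurj l).denseRange.dense_image (hcont l) hgen

theorem IsLocBdryIdeal.subset_bdryKernel (hsurj : ∀ l, Function.Surjective (π l))
    (hnorm : ∀ l a, ‖π l a‖ = p l a) (hpn : ∀ l, IsMatrixCstarSeminormFamily (p l) (pn l))
    (hS : ∀ s ∈ S, star s ∈ S) (h1 : (1 : A) ∈ S) {I : Set A} (hI : IsLocBdryIdeal pn S I) :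
    I ⊆ bdryKernel p pn S := by
  intro a ha H _ _ _ πr hπ
  obtain ⟨-, l, hle, huniq⟩ := hπ
  let _ := CStarAlgebra.spectralOrder (B l)
  let _ := CStarAlgebra.spectralOrderedRing (B l)
  obtain ⟨J, rfl⟩ := hI.1
  exact IsAdmLocBdryRep.apply_eq_zero (hpn l) (hsurj l) (hnorm l) h1 hS hI.2.1
    (fun n M C hM hC => hI.seminorm_le hpn l hM hC) hle huniq ha

end Ideal

/-- `J = ⋂_{π ∈ Ch(S)} ker π` is the largest local boundary ideal for `S`;
in particular the local Shilov boundary ideal for `S` exists and is unique. -/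
theorem stmt18 {Λ : Type*} [Preorder Λ] {A : Type*} [Ring A] [StarRing A] [Algebra ℂ A] [StarModule ℂ A]
    {B : Λ → Type*} [∀ l, NormedRing (B l)] [∀ l, StarRing (B l)] [∀ l, CStarRing (B l)]
    [∀ l, NormedAlgebra ℂ (B l)] [∀ l, StarModule ℂ (B l)] [∀ l, CompleteSpace (B l)]
    (p : Λ → A → ℝ) (hp : ∀ l, IsCstarSeminorm (p l))
    (hmono : ∀ ⦃l₁ l₂ : Λ⦄, l₁ ≤ l₂ → ∀ a, p l₁ a ≤ p l₂ a)
    (π : ∀ l, A →⋆ₐ[ℂ] B l) (hsurj : ∀ l, Function.Surjective ⇑(π l))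
    (hnorm : ∀ l a, ‖(π l) a‖ = p l a)
    (pn : Λ → ∀ n : ℕ, Matrix (Fin n) (Fin n) A → ℝ)
    (hpn : ∀ l, IsMatrixCstarSeminormFamily (p l) (pn l))
    (S : Submodule ℂ A) (hSstar : ∀ s ∈ S, star s ∈ S) (hSone : (1 : A) ∈ S)
    [TopologicalSpace A] (hind : Topology.IsInducing (fun a : A => fun l => (π l) a))
    [TopologicalSpace.SeparableSpace A]
    (hgen : closure ((StarAlgebra.adjoin ℂ (S : Set A) : StarSubalgebra ℂ A) : Set A)
      = Set.univ)
    (J : Set A)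
    (hJ : J = {a : A | ∀ (H : Type) (_ : NormedAddCommGroup H) (_ : InnerProductSpace ℂ H)
      (_ : CompleteSpace H) (πr : A →⋆ₐ[ℂ] (H →L[ℂ] H)),
      IsAdmLocBdryRep p pn S πr → πr a = 0}) :
    IsLocBdryIdeal pn S J ∧
    (∀ I : Set A, IsLocBdryIdeal pn S I → I ⊆ J) ∧
    (∀ J' : Set A,
      (IsLocBdryIdeal pn S J' ∧ ∀ I : Set A, IsLocBdryIdeal pn S I → I ⊆ J') → J' = J) := by
  let _ : ∀ l, CStarAlgebra (B l) := fun l => {}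
  have hcont : ∀ l, Continuous (π l) := fun l => (continuous_apply l).comp hind.continuous
  have hmax : ∀ I : Set A, IsLocBdryIdeal pn S I → I ⊆ J := fun I hI => by
    rw [hJ]
    exact hI.subset_bdryKernel (π := π) hsurj hnorm hpn hSstar hSone
  have hbdry : IsLocBdryIdeal pn S J := by
    rw [hJ]
    exact isLocBdryIdeal_bdryKernel (π := π) hsurj hnorm hcont hpn hSstar
      (dense_iff_closure_eq.2 hgen)
  exact ⟨hbdry, hmax, fun J' hJ' => (hmax J' hJ'.1).antisymm (hJ'.2 J hbdry)⟩
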